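/- arXiv:1902.02526 — 2 statements merged into one kernel-verified Lean document; each statement's English description precedes it below -/
import Mathlib

section
/- Let d and k be positive integers, and let G be a 2-connected graph with a d-core H such that d ≥ 5k−3 and d > |V(H)|−k, and set p = d+k−|V(H)| (so p ≥ 1). Then G has a cycle with at least d+k vertices if and only if at least one of the following holds: (i) there are distinct vertices s,t ∈ V(H) and an (s,t)-path P in G all of whose internal vertices are outside V(H) such that P has at least p internal vertices; (ii) G has a system of T-segments {P_1,…,P_r} with terminal set T = V(H) such that the total number of vertices of the paths lying outside V(H) is at least p and at most 2p−2. -/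
open SimpleGraph

/-- A (simple) path in `G`, packaged with its two end-vertices. -/
structure PathIn {V : Type*} (G : SimpleGraph V) where
  first : V
  last : V
  walk : G.Walk first last
  isPath : walk.IsPath

namespace PathIn

variable {V : Type*} {G : SimpleGraph V}

/-- The vertex set of the path. -/
def verts (P : PathIn G) : Set V := {x | x ∈ P.walk.support}

/-- The internal (non-end) vertices of the path. -/
def internals (P : PathIn G) : Set V := {x | x ∈ P.walk.support.tail.dropLast}

/-- `x` is an end-vertex of the path. -/
def IsEndpoint (P : PathIn G) (x : V) : Prop := x = P.first ∨ x = P.last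

end PathIn

/-- A path `P` is a one-terminal `T`-segment if it has at least 2 vertices, exactly
one of its end-vertices is in `T`, and all its other vertices are outside `T`. -/
def IsOneTerminalSegment {V : Type*} (G : SimpleGraph V) (T : Set V) (P : PathIn G) : Prop :=
  2 ≤ P.walk.support.length ∧
    ((P.first ∈ T ∧ ∀ x ∈ P.walk.support.tail, x ∉ T) ∨
     (P.last ∈ T ∧ ∀ x ∈ P.walk.support.dropLast, x ∉ T))

/-- A path `P` is a two-terminal `T`-segment if it has at least 3 vertices, both of
its end-vertices are in `T`, and all its internal vertices are outside `T`. -/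
def IsTwoTerminalSegment {V : Type*} (G : SimpleGraph V) (T : Set V) (P : PathIn G) : Prop :=
  3 ≤ P.walk.support.length ∧ P.first ∈ T ∧ P.last ∈ T ∧ ∀ x ∈ P.internals, x ∉ T

/-- The union of a family of paths, as a simple graph on the vertices of `G`. -/
def segUnionGraph {V : Type*} {G : SimpleGraph V} {r : ℕ} (P : Fin r → PathIn G) :
    SimpleGraph V :=
  (⨆ i, (P i).walk.toSubgraph).spanningCoe

/-- A linear forest: a graph each of whose connected components is a path,
equivalently (for finite graphs) an acyclic graph of maximum degree at most 2. -/
def IsLinearForest {V : Type*} (F : SimpleGraph V) : Prop :=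
  F.IsAcyclic ∧ ∀ v : V, (F.neighborSet v).ncard ≤ 2

/-- The paths `P i` are pairwise internally vertex-disjoint: a common vertex of two
of the paths must be an end-vertex of both. -/
def InternallyDisjoint {V : Type*} {G : SimpleGraph V} {r : ℕ} (P : Fin r → PathIn G) : Prop :=
  ∀ i j : Fin r, i ≠ j → ∀ x : V, x ∈ (P i).verts → x ∈ (P j).verts →
    (P i).IsEndpoint x ∧ (P j).IsEndpoint x

/-- A system of `T`-segments: a family of two-terminal `T`-segments that are pairwise
internally vertex-disjoint and whose union is a linear forest. -/
def IsSegmentSystem {V : Type*} (G : SimpleGraph V) (T : Set V) {r : ℕ}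
    (P : Fin r → PathIn G) : Prop :=
  (∀ i, IsTwoTerminalSegment G T (P i)) ∧
  InternallyDisjoint P ∧
  IsLinearForest (segUnionGraph P)

/-- An extended system of `T`-segments: (i) at least one and at most two of the paths
are one-terminal `T`-segments and the remaining ones are two-terminal `T`-segments;
(ii) the paths are pairwise internally vertex-disjoint and the end-vertex outside `T`
of each one-terminal segment is distinct from all other vertices of the paths;
(iii) the union of the paths is a linear forest, and if there are two one-terminal
segments then their vertices lie in distinct components of this forest. -/
def IsExtendedSegmentSystem {V : Type*} (G : SimpleGraph V) (T : Set V) {r : ℕ}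
    (P : Fin r → PathIn G) : Prop :=
  (∃ i, IsOneTerminalSegment G T (P i)) ∧
  (∀ i j l : Fin r, IsOneTerminalSegment G T (P i) → IsOneTerminalSegment G T (P j) →
      IsOneTerminalSegment G T (P l) → i = j ∨ i = l ∨ j = l) ∧
  (∀ i, IsOneTerminalSegment G T (P i) ∨ IsTwoTerminalSegment G T (P i)) ∧
  InternallyDisjoint P ∧
  (∀ i, IsOneTerminalSegment G T (P i) → ∀ x : V, (P i).IsEndpoint x → x ∉ T →
      ∀ j, j ≠ i → x ∉ (P j).verts) ∧
  IsLinearForest (segUnionGraph P) ∧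
  (∀ i j : Fin r, i ≠ j → IsOneTerminalSegment G T (P i) → IsOneTerminalSegment G T (P j) →
      ∀ x ∈ (P i).verts, ∀ y ∈ (P j).verts, ¬ (segUnionGraph P).Reachable x y)

/-- The total number of vertices of the paths of the family lying outside `T`. -/
noncomputable def outsideCount {V : Type*} {G : SimpleGraph V} {r : ℕ} (T : Set V)
    (P : Fin r → PathIn G) : ℕ :=
  ((⋃ i, (P i).verts) \ T).ncard

/-- `H` is a `d`-core of `G`: an inclusion-maximal vertex set inducing a connected
subgraph of minimum degree at least `d`. -/
def IsDCore {V : Type*} (G : SimpleGraph V) (d : ℕ) (H : Set V) : Prop :=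
  (G.induce H).Connected ∧
  (∀ v ∈ H, d ≤ (G.neighborSet v ∩ H).ncard) ∧
  ∀ H' : Set V, H ⊆ H' → (G.induce H').Connected →
    (∀ v ∈ H', d ≤ (G.neighborSet v ∩ H').ncard) → H' = H

section ListOrders

variable {V : Type*}

open Classical in
/-- The number of consecutive pairs of the list `l` that are not related by `R`. -/
noncomputable def badPairs (R : V → V → Prop) : List V → ℕ
  | [] => 0
  | [_] => 0
  | a :: b :: l => (if R a b then 0 else 1) + badPairs R (b :: l)

open Classical in
/-- The cost (`0` or `1`) of putting the list `m` right behind the list `l`. -/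
noncomputable def linkCost (R : V → V → Prop) (l m : List V) : ℕ :=
  if ∀ x ∈ l.getLast?, ∀ y ∈ m.head?, R x y then 0 else 1

/-- The number of cyclically consecutive pairs of `l` that are not related by `R`. -/
noncomputable def cyclicBad (R : V → V → Prop) (l : List V) : ℕ :=
  badPairs R l + linkCost R l l

variable {R S : V → V → Prop}

lemma linkCost_le_one (l m : List V) : linkCost R l m ≤ 1 := by
  unfold linkCost; split_ifs <;> simp

lemma linkCost_eq_zero_iff {l m : List V} :
    linkCost R l m = 0 ↔ ∀ x ∈ l.getLast?, ∀ y ∈ m.head?, R x y := by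
  unfold linkCost
  split_ifs with h
  · exact iff_of_true rfl h
  · exact iff_of_false id h

lemma linkCost_append_left {l₁ l₂ m : List V} (h : l₂ ≠ []) :
    linkCost R (l₁ ++ l₂) m = linkCost R l₂ m := by
  unfold linkCost; rw [List.getLast?_append_of_ne_nil _ h]

lemma linkCost_append_right {l m₁ m₂ : List V} (h : m₁ ≠ []) :
    linkCost R l (m₁ ++ m₂) = linkCost R l m₁ := by
  unfold linkCost; rw [List.head?_append_of_ne_nil _ h]

lemma linkCost_reverse (hR : ∀ x y, R x y → R y x) (l m : List V) :
    linkCost R l.reverse m.reverse = linkCost R m l := by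
  have hs : ∀ x y, R x y ↔ R y x := fun x y => ⟨hR x y, hR y x⟩
  unfold linkCost
  congr 1
  simp only [List.getLast?_reverse, List.head?_reverse, eq_iff_iff]
  exact ⟨fun h x hx y hy => hR _ _ (h y hy x hx), fun h x hx y hy => hR _ _ (h y hy x hx)⟩

lemma badPairs_cons (a : V) (l : List V) :
    badPairs R (a :: l) = linkCost R [a] l + badPairs R l := by
  cases l with
  | nil => simp [badPairs, linkCost]
  | cons b l =>
    rw [badPairs, linkCost]
    congr 2
    simp

lemma badPairs_append (l m : List V) :
    badPairs R (l ++ m) = badPairs R l + linkCost R l m + badPairs R m := by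
  induction l with
  | nil => simp [badPairs, linkCost]
  | cons a l ih =>
    rcases eq_or_ne l [] with rfl | hl
    · simp [badPairs_cons, badPairs, linkCost]
    · rw [List.cons_append, badPairs_cons, ih, badPairs_cons, linkCost_append_right hl,
        show a :: l = [a] ++ l from rfl, linkCost_append_left hl]
      ring

lemma badPairs_reverse (hR : ∀ x y, R x y → R y x) (l : List V) :
    badPairs R l.reverse = badPairs R l := by
  induction l with
  | nil => rfl
  | cons a l ih =>
    have h := linkCost_reverse hR l [a]
    rw [List.reverse_singleton] at h
    rw [List.reverse_cons, badPairs_append, ih, h, badPairs_cons a l, badPairs, add_zero, add_comm]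

lemma cyclicBad_append {l m : List V} (hl : l ≠ []) (hm : m ≠ []) :
    cyclicBad R (l ++ m) =
      badPairs R l + linkCost R l m + badPairs R m + linkCost R m l := by
  rw [cyclicBad, badPairs_append, linkCost_append_left hm, linkCost_append_right hl]

lemma cyclicBad_append_comm (l m : List V) :
    cyclicBad R (l ++ m) = cyclicBad R (m ++ l) := by
  rcases eq_or_ne l [] with rfl | hl
  · simp
  rcases eq_or_ne m [] with rfl | hm
  · simp
  rw [cyclicBad_append hl hm, cyclicBad_append hm hl]
  ring

lemma cyclicBad_reverse (hR : ∀ x y, R x y → R y x) (l : List V) :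
    cyclicBad R l.reverse = cyclicBad R l := by
  rw [cyclicBad, badPairs_reverse hR, linkCost_reverse hR, cyclicBad]

lemma badPairs_eq_zero_iff {l : List V} : badPairs R l = 0 ↔ l.IsChain R := by
  induction l with
  | nil => simp [badPairs]
  | cons a l ih =>
    rw [badPairs_cons, Nat.add_eq_zero_iff, ih, linkCost_eq_zero_iff, List.isChain_cons]
    simp

lemma isChain_of_isInfix {l m : List V} (h : l <:+: m) (hm : m.IsChain R) : l.IsChain R := by
  obtain ⟨a, b, rfl⟩ := h
  exact hm.left_of_append.right_of_append

/-- A list with a bad consecutive pair splits at this pair. -/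
lemma exists_split_of_badPairs_ne_zero {l : List V} (h : badPairs R l ≠ 0) :
    ∃ l₁ l₂, l₁ ≠ [] ∧ l₂ ≠ [] ∧ l = l₁ ++ l₂ ∧ linkCost R l₁ l₂ = 1 := by
  induction l with
  | nil => simp [badPairs] at h
  | cons a l ih =>
    rw [badPairs_cons] at h
    by_cases h1 : linkCost R [a] l = 0
    · obtain ⟨l₁, l₂, h₁, h₂, rfl, h₃⟩ := ih (by omega)
      refine ⟨a :: l₁, l₂, by simp, h₂, rfl, ?_⟩
      rw [show a :: l₁ = [a] ++ l₁ from rfl, linkCost_append_left h₁, h₃]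
    · have := linkCost_le_one (R := R) [a] l
      refine ⟨[a], l, by simp, ?_, rfl, by omega⟩
      rintro rfl
      simp [linkCost] at h1

/-- A cyclic order with a bad pair can be rotated so that the bad pair is the closing one. -/
lemma exists_rotation_of_cyclicBad_ne_zero {l : List V} (h : cyclicBad R l ≠ 0) :
    ∃ m : List V, m.Perm l ∧ (∀ S : V → V → Prop, cyclicBad S m = cyclicBad S l) ∧
      linkCost R m m = 1 := by
  by_cases h0 : badPairs R l = 0
  · have := linkCost_le_one (R := R) l l
    refine ⟨l, .refl l, fun S => rfl, ?_⟩
    unfold cyclicBad at h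
    omega
  · obtain ⟨l₁, l₂, h₁, h₂, rfl, h₃⟩ := exists_split_of_badPairs_ne_zero h0
    refine ⟨l₂ ++ l₁, List.perm_append_comm, fun S => cyclicBad_append_comm _ _, ?_⟩
    rw [linkCost_append_left h₁, linkCost_append_right h₂, h₃]

/-- If no consecutive pair of `l` satisfies `P` in its first and `Q` in its second entry, then
`P` and `Q` together hold rarely. -/
lemma exists_split_of_lt_countP (P Q : V → Bool) (l : List V)
    (h : l.length ≤ l.dropLast.countP P + l.tail.countP Q) (hl : l ≠ []) :
    ∃ l₁ x y l₂, l = l₁ ++ x :: y :: l₂ ∧ P x ∧ Q y := by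
  induction l with
  | nil => exact absurd rfl hl
  | cons a l ih =>
    cases l with
    | nil => simp at h
    | cons b l =>
      by_cases hab : P a ∧ Q b
      · exact ⟨[], a, b, l, rfl, hab⟩
      · obtain ⟨l₁, x, y, l₂, e, hx⟩ := ih (by
          rw [List.dropLast_cons_of_ne_nil (by simp), List.countP_cons, List.tail_cons,
            List.countP_cons] at h
          rw [List.tail_cons]
          simp only [List.length_cons] at h ⊢
          split_ifs at h <;> first | (exfalso; tauto) | omega) (by simp)
        exact ⟨a :: l₁, x, y, l₂, by rw [e]; rfl, hx⟩

end ListOrders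

section Closing

variable {V : Type*}

open Classical in
lemma ncard_le_countP {s : Set V} {l : List V} (h : ∀ x ∈ s, x ∈ l) :
    s.ncard ≤ l.countP (fun x => decide (x ∈ s)) := by
  rw [List.countP_eq_length_filter]
  calc s.ncard ≤ ((l.filter (fun x => decide (x ∈ s))).toFinset : Set V).ncard :=
        Set.ncard_le_ncard (fun x hx => by simp [hx, h x hx]) (Finset.finite_toSet _)
    _ ≤ _ := by rw [Set.ncard_coe_finset]; exact List.toFinset_card_le _

/-- A cyclic order of vertices, each of whose consecutive pairs is an edge or lies in the set `H`
of vertices with high degree into `H`, can be rearranged into a cyclic order with all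
consecutive pairs adjacent. -/
lemma exists_perm_cyclicBad_eq_zero (K : SimpleGraph V) (H : Set V) (d : ℕ)
    (hdeg : ∀ v ∈ H, d ≤ (K.neighborSet v ∩ H).ncard) (l : List V)
    (hH : ∀ x ∈ H, x ∈ l) (hlen : l.length ≤ 2 * d)
    (hl : cyclicBad (fun x y => K.Adj x y ∨ x ∈ H ∧ y ∈ H) l = 0) :
    ∃ m : List V, m.Perm l ∧ cyclicBad K.Adj m = 0 := by
  classical
  induction hn : cyclicBad K.Adj l using Nat.strong_induction_on generalizing l with
  | _ n ih =>
    subst hn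
    by_cases h0 : cyclicBad K.Adj l = 0
    · exact ⟨l, .refl l, h0⟩
    obtain ⟨m, hml, hcost, hlink⟩ := exists_rotation_of_cyclicBad_ne_zero h0
    have hmne : m ≠ [] := by
      rintro rfl
      simp [linkCost] at hlink
    rw [← hcost] at hl
    have hl' := hl
    rw [cyclicBad, Nat.add_eq_zero_iff, linkCost_eq_zero_iff] at hl'
    have hlink' : ¬ linkCost K.Adj m m = 0 := by omega
    rw [linkCost_eq_zero_iff] at hlink'
    push Not at hlink'
    obtain ⟨u, hu, v, hv, huv⟩ := hlink'
    obtain ⟨huH, hvH⟩ := (hl'.2 u hu v hv).resolve_left huv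
    have hm1 : m = m.dropLast ++ [u] := (List.dropLast_append_getLast? u hu).symm
    have hm2 : m = v :: m.tail := (List.cons_head?_tail hv).symm
    have c1 := ncard_le_countP (s := K.neighborSet u ∩ H) (l := m.dropLast) (by
      rintro x ⟨hx, hxH⟩
      have := hml.mem_iff.2 (hH x hxH)
      rw [hm1, List.mem_append, List.mem_singleton] at this
      refine this.resolve_right ?_
      rintro rfl
      exact K.loopless.irrefl _ hx)
    have c2 := ncard_le_countP (s := K.neighborSet v ∩ H) (l := m.tail) (by
      rintro x ⟨hx, hxH⟩
      have := hml.mem_iff.2 (hH x hxH)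
      rw [hm2, List.mem_cons] at this
      refine this.resolve_left ?_
      rintro rfl
      exact K.loopless.irrefl _ hx)
    obtain ⟨l₁, x, y, l₂, e, hx, hy⟩ := exists_split_of_lt_countP _ _ m (by
      have h1 := hml.length_eq
      have h2 := hdeg u huH
      have h3 := hdeg v hvH
      exact le_trans (by omega) (add_le_add c1 c2)) hmne
    simp only [Set.mem_inter_iff, SimpleGraph.mem_neighborSet, decide_eq_true_eq] at hx hy
    have e' : m = (l₁ ++ [x]) ++ (y :: l₂) := by simp [e]
    have hu' : u ∈ (y :: l₂).getLast? := by
      rw [e', List.getLast?_append_of_ne_nil _ (by simp)] at hu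
      exact hu
    have hv' : v ∈ (l₁ ++ [x]).head? := by
      rw [e', List.head?_append_of_ne_nil _ (by simp)] at hv
      exact hv
    have key : ∀ S : V → V → Prop, S x u → S y v →
        cyclicBad S ((l₁ ++ [x]) ++ (y :: l₂).reverse) =
          badPairs S (l₁ ++ [x]) + badPairs S (y :: l₂).reverse := by
      intro S h1 h2
      rw [cyclicBad_append (by simp) (by simp)]
      have h3 : linkCost S (l₁ ++ [x]) (y :: l₂).reverse = 0 := by
        rw [linkCost_eq_zero_iff]
        intro a ha b hb
        rw [List.head?_reverse] at hb
        simp only [List.getLast?_append, List.getLast?_singleton, Option.some_or,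
          Option.mem_some_iff] at ha
        rw [← ha, ← Option.mem_unique hu' hb]
        exact h1
      have h4 : linkCost S (y :: l₂).reverse (l₁ ++ [x]) = 0 := by
        rw [linkCost_eq_zero_iff]
        intro a ha b hb
        rw [List.getLast?_reverse] at ha
        simp only [List.head?_cons, Option.mem_some_iff] at ha
        rw [← ha, ← Option.mem_unique hv' hb]
        exact h2
      omega
    have hperm : ((l₁ ++ [x]) ++ (y :: l₂).reverse).Perm l :=
      ((List.reverse_perm _).append_left _).trans (e' ▸ hml)
    have hKs : ∀ a b, K.Adj a b → K.Adj b a := fun a b h => h.symm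
    have hRs : ∀ a b, (K.Adj a b ∨ a ∈ H ∧ b ∈ H) → (K.Adj b a ∨ b ∈ H ∧ a ∈ H) :=
      fun a b h => h.imp (fun h => h.symm) (fun h => h.symm)
    obtain ⟨m', hm', hz⟩ := ih _ (by
      rw [key _ hx.1.symm hy.1.symm, badPairs_reverse hKs, ← hcost, cyclicBad, hlink, e',
        badPairs_append (l₁ ++ [x]) (y :: l₂)]
      omega) _ (fun z hz => hperm.mem_iff.2 (hH z hz)) (by rw [hperm.length_eq]; exact hlen) (by
      rw [key _ (Or.inl hx.1.symm) (Or.inl hy.1.symm), badPairs_reverse hRs]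
      rw [e', badPairs_append (l₁ ++ [x]) (y :: l₂)] at hl'
      omega) rfl
    exact ⟨m', hm'.trans hperm, hz⟩

/-- A cyclic order of at least three vertices with consecutive vertices adjacent is a cycle. -/
lemma exists_isCycle_of_cyclicBad_eq_zero {K : SimpleGraph V} {l : List V} (hl : l.Nodup)
    (h3 : 3 ≤ l.length) (h0 : cyclicBad K.Adj l = 0) :
    ∃ (v : V) (c : K.Walk v v), c.IsCycle ∧ c.length = l.length := by
  rw [cyclicBad, Nat.add_eq_zero_iff, badPairs_eq_zero_iff, linkCost_eq_zero_iff] at h0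
  have hne : l ≠ [] := by rintro rfl; simp at h3
  have hadj : K.Adj (l.getLast hne) (l.head hne) :=
    h0.2 _ (List.getLast?_eq_some_getLast hne) _ (List.head?_eq_some_head hne)
  let q := SimpleGraph.Walk.ofSupport l hne h0.1
  have hq : q.support = l := SimpleGraph.Walk.support_ofSupport hne h0.1
  have hql : q.length = l.length - 1 := SimpleGraph.Walk.length_ofSupport hne h0.1
  have hqp : q.IsPath := by rw [SimpleGraph.Walk.isPath_def, hq]; exact hl
  refine ⟨_, SimpleGraph.Walk.cons hadj q, ?_, ?_⟩
  · rw [SimpleGraph.Walk.cons_isCycle_iff]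
    refine ⟨hqp, fun he => ?_⟩
    have := hqp.length_eq_one_of_mem_edges (Sym2.eq_swap ▸ he)
    omega
  · rw [SimpleGraph.Walk.length_cons]
    omega

end Closing

section LinearForestOrder

variable {V : Type*}

/-- In an acyclic graph, a cyclic order of at least three vertices is not a cycle. -/
lemma SimpleGraph.IsAcyclic.cyclicBad_ne_zero {F : SimpleGraph V} (hF : F.IsAcyclic) {l : List V}
    (hl : l.Nodup) (h3 : 3 ≤ l.length) : cyclicBad F.Adj l ≠ 0 := fun h0 => by
  obtain ⟨v, c, hc, -⟩ := exists_isCycle_of_cyclicBad_eq_zero hl h3 h0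
  exact hF c hc

/-- In a cyclic order of vertices of a linear forest with the least number of non-adjacent
consecutive pairs, these pairs consist of vertices of degree at most one. -/
lemma ncard_neighborSet_le_one_of_minimal [Finite V] {F : SimpleGraph V} (hF : IsLinearForest F)
    {l : List V} (hl : l.Nodup)
    (hmin : ∀ m : List V, m.Perm l → cyclicBad F.Adj l ≤ cyclicBad F.Adj m)
    (hlink : linkCost F.Adj l l = 1) {u : V} (hu : u ∈ l.getLast?)
    (hnb : ∀ y, F.Adj u y → y ∈ l) : (F.neighborSet u).ncard ≤ 1 := by
  classical
  by_contra hdeg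
  rw [not_le, Set.one_lt_ncard] at hdeg
  have hFs : ∀ a b, F.Adj a b → F.Adj b a := fun a b h => h.symm
  obtain ⟨m, rfl⟩ : ∃ m, l = m ++ [u] := ⟨_, (List.dropLast_append_getLast? u hu).symm⟩
  obtain ⟨y, huy, hym⟩ : ∃ y, F.Adj u y ∧ y ∉ m.getLast? := by
    obtain ⟨a, ha, b, hb, hab⟩ := hdeg
    by_cases h : a ∈ m.getLast?
    · exact ⟨b, hb, fun h' => hab (Option.mem_unique h h')⟩
    · exact ⟨a, ha, h⟩
  have hy : y ∈ m := by
    have := hnb y huy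
    rw [List.mem_append, List.mem_singleton] at this
    exact this.resolve_right (by rintro rfl; exact F.loopless.irrefl _ huy)
  obtain ⟨l₁, l₂, rfl⟩ := List.append_of_mem hy
  have hl₂ : l₂ ≠ [] := by
    rintro rfl
    simp at hym
  obtain ⟨z, l₃, rfl⟩ := List.exists_cons_of_ne_nil hl₂
  have hgl : ∀ c : List V, ∀ t ∈ (c ++ [u]).getLast?, t = u := by
    intro c t ht
    simpa using ht.symm
  have hcost : cyclicBad F.Adj (l₁ ++ y :: z :: l₃ ++ [u]) =
      badPairs F.Adj (l₁ ++ y :: z :: l₃ ++ [u]) + 1 := by rw [cyclicBad, hlink]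
  have hyz : F.Adj y z := by
    by_contra hyz
    have h1 := hmin ((l₁ ++ [y]) ++ (z :: l₃ ++ [u]).reverse) (by
      refine ((List.reverse_perm _).append_left _).trans ?_
      simp)
    rw [hcost, show l₁ ++ y :: z :: l₃ ++ [u] = (l₁ ++ [y]) ++ (z :: l₃ ++ [u]) by simp,
      cyclicBad_append (by simp) (by simp), badPairs_append (l₁ ++ [y]),
      badPairs_reverse hFs] at h1
    have h2 : linkCost F.Adj (l₁ ++ [y]) (z :: l₃ ++ [u]).reverse = 0 := by
      rw [linkCost_eq_zero_iff]
      simpa using huy.symm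
    have h3 : linkCost F.Adj (l₁ ++ [y]) (z :: l₃ ++ [u]) ≠ 0 := by
      rw [Ne, linkCost_eq_zero_iff]
      simpa using hyz
    have h4 := linkCost_le_one (R := F.Adj) (z :: l₃ ++ [u]).reverse (l₁ ++ [y])
    omega
  have hl₁ : l₁ ≠ [] := by
    rintro rfl
    have : linkCost F.Adj ([] ++ y :: z :: l₃ ++ [u]) ([] ++ y :: z :: l₃ ++ [u]) = 0 := by
      rw [linkCost_eq_zero_iff]
      intro a ha b hb
      rw [hgl _ a ha, show b = y by simpa using hb.symm]
      exact huy
    omega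
  have h5 : linkCost F.Adj l₁ (y :: z :: l₃ ++ [u]) = 1 := by
    have := linkCost_le_one (R := F.Adj) l₁ (y :: z :: l₃ ++ [u])
    by_contra hne
    have h0 : linkCost F.Adj l₁ (y :: z :: l₃ ++ [u]) = 0 := by omega
    rw [linkCost_eq_zero_iff] at h0
    obtain ⟨w, hw⟩ : ∃ w, w ∈ l₁.getLast? := ⟨_, List.getLast?_eq_some_getLast hl₁⟩
    have hwy : F.Adj w y := h0 w hw y (by simp)
    have hwm : w ∈ l₁ := List.mem_of_getLast? hw
    have hsub : ({w, z, u} : Set V) ⊆ F.neighborSet y := by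
      rintro t (rfl | rfl | rfl)
      exacts [hwy.symm, hyz, huy.symm]
    have hw1 : w ≠ z := by grind [List.nodup_append]
    have hw2 : w ≠ u := by grind [List.nodup_append]
    have hzu : z ≠ u := by grind [List.nodup_append]
    have h3 : ({w, z, u} : Set V).ncard = 3 := Set.ncard_eq_three.2 ⟨w, z, u, hw1, hw2, hzu, rfl⟩
    have := Set.ncard_le_ncard hsub
    have := hF.2 y
    omega
  have hlast : linkCost F.Adj (y :: z :: l₃ ++ [u]) (y :: z :: l₃ ++ [u]) = 0 := by
    rw [linkCost_eq_zero_iff]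
    intro a ha b hb
    rw [hgl _ a ha, show b = y by simpa using hb.symm]
    exact huy
  by_cases h6 : badPairs F.Adj (y :: z :: l₃ ++ [u]) = 0
  · refine hF.1.cyclicBad_ne_zero (l := y :: z :: l₃ ++ [u]) ?_ (by simp) ?_
    · rw [List.append_assoc] at hl
      exact hl.of_append_right
    · rw [cyclicBad, h6, hlast]
  · obtain ⟨a, b, ha, hb, e, hab⟩ := exists_split_of_badPairs_ne_zero h6
    have h7 := hmin (l₁ ++ (a.reverse ++ b.reverse)) (by
      rw [List.append_assoc, e]
      exact ((List.reverse_perm _).append (List.reverse_perm _)).append_left _)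
    rw [hcost, List.append_assoc, badPairs_append, h5, e, badPairs_append, hab,
      cyclicBad_append hl₁ (by simpa using fun h => absurd h ha), badPairs_append a.reverse,
      badPairs_reverse hFs, badPairs_reverse hFs, linkCost_reverse hFs] at h7
    rw [e, linkCost_append_left hb, linkCost_append_right ha] at hlast
    have h8 := linkCost_le_one (R := F.Adj) l₁ (a.reverse ++ b.reverse)
    have h9 := linkCost_le_one (R := F.Adj) (a.reverse ++ b.reverse) l₁
    omega

/-- The vertices of a linear forest have a cyclic order whose consecutive pairs are edges of the
forest or pairs of vertices in `H`, if `H` contains all vertices of degree at most one. -/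
lemma IsLinearForest.exists_cyclic_order [Finite V] {F : SimpleGraph V} (hF : IsLinearForest F)
    (U H : Set V) (hU : ∀ x ∈ U, ∀ y, F.Adj x y → y ∈ U)
    (hdeg : ∀ x ∈ U, x ∉ H → 2 ≤ (F.neighborSet x).ncard) :
    ∃ l : List V, l.Nodup ∧ (∀ x, x ∈ l ↔ x ∈ U) ∧
      cyclicBad (fun x y => F.Adj x y ∨ x ∈ H ∧ y ∈ H) l = 0 := by
  classical
  have hFs : ∀ a b, F.Adj a b → F.Adj b a := fun a b h => h.symm
  let s := U.toFinite.toFinset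
  obtain ⟨l, hls, hmin⟩ := WellFounded.has_min
    (InvImage.wf (cyclicBad F.Adj) Nat.lt_wfRel.wf) {l : List V | l.Perm s.toList}
    ⟨_, List.Perm.refl _⟩
  have hmem : ∀ {m : List V}, m.Perm s.toList → ∀ x, x ∈ m ↔ x ∈ U := fun hm x => by
    simp [hm.mem_iff, s]
  have hnd : ∀ {m : List V}, m.Perm s.toList → m.Nodup := fun hm =>
    hm.nodup_iff.2 s.nodup_toList
  have main : ∀ m : List V, m.Perm s.toList → cyclicBad F.Adj m = cyclicBad F.Adj l →
      linkCost F.Adj m m = 1 → ∀ u ∈ m.getLast?, u ∈ H := by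
    intro m hm hc hlink u hu
    by_contra huH
    have huU := (hmem hm u).1 (List.mem_of_getLast? hu)
    have := ncard_neighborSet_le_one_of_minimal hF (hnd hm) (fun m' hm' => by
      rw [hc]
      exact not_lt.1 (hmin m' (hm'.trans hm))) hlink hu
      (fun y hy => (hmem hm y).2 (hU u huU y hy))
    have := hdeg u huU huH
    omega
  refine ⟨l, hnd hls, hmem hls, ?_⟩
  by_contra hne
  obtain ⟨m, hml, hcost, hlink⟩ := exists_rotation_of_cyclicBad_ne_zero hne
  have hm := hml.trans hls
  have hnl : ¬ linkCost (fun x y => F.Adj x y ∨ x ∈ H ∧ y ∈ H) m m = 0 := by omega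
  rw [linkCost_eq_zero_iff] at hnl
  push Not at hnl
  obtain ⟨u, hu, v, hv, huv, hH⟩ := hnl
  have hF1 : linkCost F.Adj m m = 1 := by
    have h1 := linkCost_le_one (R := F.Adj) m m
    have h2 : ¬ linkCost F.Adj m m = 0 := by
      rw [linkCost_eq_zero_iff]
      exact fun h => huv (h u hu v hv)
    omega
  refine hH (main m hm (hcost _) hF1 u hu) (main m.reverse ((List.reverse_perm m).trans hm)
    ((cyclicBad_reverse hFs m).trans (hcost _)) ((linkCost_reverse hFs m m).trans hF1) v ?_)
  rw [List.getLast?_reverse]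
  exact hv

end LinearForestOrder

section Sufficiency

variable {V : Type*} {G : SimpleGraph V}

lemma segUnionGraph_adj {r : ℕ} {P : Fin r → PathIn G} {x y : V} :
    (segUnionGraph P).Adj x y ↔ ∃ i, (P i).walk.toSubgraph.Adj x y := by
  simp [segUnionGraph]

lemma segUnionGraph_le {r : ℕ} (P : Fin r → PathIn G) : segUnionGraph P ≤ G := by
  intro x y h
  obtain ⟨i, hi⟩ := segUnionGraph_adj.1 h
  exact hi.adj_sub

lemma cyclicBad_eq_zero_mono {R S : V → V → Prop} (h : ∀ x y, R x y → S x y) {l : List V}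
    (hl : cyclicBad R l = 0) : cyclicBad S l = 0 := by
  rw [cyclicBad, Nat.add_eq_zero_iff, badPairs_eq_zero_iff, linkCost_eq_zero_iff] at hl ⊢
  exact ⟨hl.1.imp h, fun x hx y hy => h x y (hl.2 x hx y hy)⟩

/-- A system of `H`-segments with few vertices outside `H` extends to a cycle through all vertices
of `H` and of the segments. -/
lemma exists_isCycle_of_isSegmentSystem [Finite V] {H : Set V} {d r : ℕ}
    (hdeg : ∀ v ∈ H, d ≤ (G.neighborSet v ∩ H).ncard) {P : Fin r → PathIn G}
    (hP : IsSegmentSystem G H P) (hcount : H.ncard + outsideCount H P ≤ 2 * d)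
    (h3 : 3 ≤ H.ncard + outsideCount H P) :
    ∃ (v : V) (c : G.Walk v v), c.IsCycle ∧ c.length = H.ncard + outsideCount H P := by
  classical
  obtain ⟨hseg, -, hforest⟩ := hP
  obtain ⟨l, hnd, hmem, hl⟩ := hforest.exists_cyclic_order (H ∪ ⋃ i, (P i).verts) H
    (by
      intro x _ y hxy
      obtain ⟨i, hi⟩ := segUnionGraph_adj.1 hxy
      refine Or.inr (Set.mem_iUnion.2 ⟨i, ?_⟩)
      exact (SimpleGraph.Walk.mem_verts_toSubgraph _).1 hi.snd_mem)
    (by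
      intro x hx hxH
      obtain ⟨i, hi⟩ := Set.mem_iUnion.1 (hx.resolve_left hxH)
      obtain ⟨-, hf, hl, -⟩ := hseg i
      obtain ⟨j, rfl, hj⟩ := SimpleGraph.Walk.mem_support_iff_exists_getVert.1 hi
      have h0 : j ≠ 0 := by
        rintro rfl
        rw [SimpleGraph.Walk.getVert_zero] at hxH
        exact hxH hf
      have hlt : j < (P i).walk.length := by
        refine lt_of_le_of_ne hj ?_
        rintro rfl
        rw [SimpleGraph.Walk.getVert_length] at hxH
        exact hxH hl
      rw [← (P i).isPath.ncard_neighborSet_toSubgraph_internal_eq_two h0 hlt]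
      exact Set.ncard_le_ncard fun y hy => segUnionGraph_adj.2 ⟨i, hy⟩)
  have hlen : l.length = H.ncard + outsideCount H P := by
    rw [outsideCount, ← Set.ncard_union_eq Set.disjoint_sdiff_right, Set.union_sdiff_self,
      ← List.toFinset_card_of_nodup hnd, ← Set.ncard_coe_finset]
    congr 1
    ext x
    simp [hmem]
  obtain ⟨m, hml, hm⟩ := exists_perm_cyclicBad_eq_zero G H d hdeg l
    (fun x hx => (hmem x).2 (Or.inl hx)) (by omega)
    (cyclicBad_eq_zero_mono (fun x y h => h.imp_left fun h => segUnionGraph_le P h) hl)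
  have := hml.length_eq
  obtain ⟨v, c, hc, hcl⟩ := exists_isCycle_of_cyclicBad_eq_zero (hml.nodup_iff.2 hnd) (by omega) hm
  exact ⟨v, c, hc, by omega⟩

/-- A set `H` of vertices of high degree into `H` is spanned by a path with prescribed ends. -/
lemma exists_spanning_path [Finite V] {H : Set V} {d : ℕ}
    (hdeg : ∀ v ∈ H, d ≤ (G.neighborSet v ∩ H).ncard) (hcard : H.ncard + 1 ≤ 2 * d) {s t w : V}
    (hs : s ∈ H) (ht : t ∈ H) (hst : s ≠ t) (hw : w ∉ H) :
    ∃ l : List V, l.Nodup ∧ (∀ x, x ∈ l ↔ x ∈ H) ∧ l.IsChain G.Adj ∧ l.head? = some t ∧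
      l.getLast? = some s := by
  classical
  let K : SimpleGraph V := SimpleGraph.fromRel fun x y =>
    (x ∈ H ∧ y ∈ H ∧ G.Adj x y) ∨ x = w ∧ (y = s ∨ y = t)
  have hsw : s ≠ w := by rintro rfl; exact hw hs
  have htw : t ≠ w := by rintro rfl; exact hw ht
  have hKG : ∀ x y, K.Adj x y → x ≠ w → y ≠ w → G.Adj x y := by
    intro x y h hx hy
    simp only [K, SimpleGraph.fromRel_adj, hx, hy, false_and, or_false] at h
    rcases h with ⟨-, h | h⟩
    exacts [h.2.2, h.2.2.symm]
  have hKH : ∀ x ∈ H, ∀ y ∈ H, G.Adj x y → K.Adj x y := by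
    intro x hx y hy h
    simp only [K, SimpleGraph.fromRel_adj]
    exact ⟨h.ne, Or.inl (Or.inl ⟨hx, hy, h⟩)⟩
  have hKw : ∀ y, K.Adj w y → y = s ∨ y = t := by
    intro y h
    simp only [K, SimpleGraph.fromRel_adj, hw, false_and, and_false, false_or, true_and] at h
    rcases h with ⟨-, h | h⟩
    · exact h
    · rcases h.2 with h | h
      exacts [absurd h.symm hsw, absurd h.symm htw]
  have hKs : K.Adj w s := by simp [K, hsw.symm]
  have hKt : K.Adj w t := by simp [K, htw.symm]
  let f := H.toFinite.toFinset
  let l₀ : List V := w :: t :: ((f.erase s).erase t).toList ++ [s]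
  have hl₀ : ∀ x, x ∈ l₀ ↔ x = w ∨ x ∈ H := by
    intro x
    simp only [l₀, f, List.cons_append, List.mem_cons, List.mem_append, Finset.mem_toList,
      Finset.mem_erase, Set.Finite.mem_toFinset, List.not_mem_nil, or_false]
    constructor
    · rintro (h | rfl | h | rfl)
      exacts [Or.inl h, Or.inr ht, Or.inr h.2.2, Or.inr hs]
    · rintro (h | h)
      · exact Or.inl h
      · by_cases h1 : x = t
        · exact Or.inr (Or.inl h1)
        · by_cases h2 : x = s
          · exact Or.inr (Or.inr (Or.inr h2))
          · exact Or.inr (Or.inr (Or.inl ⟨h1, h2, h⟩))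
  have hnd₀ : l₀.Nodup := by
    have hn := ((f.erase s).erase t).nodup_toList
    simp only [l₀, f] at hn ⊢
    simp [List.nodup_append, hn, hw, hst.symm, htw.symm, hsw.symm]
    exact fun a _ h _ => h
  have hlen₀ : l₀.length = H.ncard + 1 := by
    rw [← List.toFinset_card_of_nodup hnd₀, ← Set.ncard_coe_finset,
      ← Set.ncard_insert_of_notMem hw]
    congr 1
    ext x
    simp [hl₀]
  have hKR : ∀ x y, (x = w → K.Adj w y) → (y = w → K.Adj x w) →
      (x ≠ w → x ∈ H) → (y ≠ w → y ∈ H) → K.Adj x y ∨ x ∈ H ∧ y ∈ H := by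
    intro x y h1 h2 h3 h4
    by_cases hx : x = w
    · exact Or.inl (hx ▸ h1 hx)
    by_cases hy : y = w
    · exact Or.inl (hy ▸ h2 hy)
    exact Or.inr ⟨h3 hx, h4 hy⟩
  obtain ⟨m, hm, hm0⟩ := exists_perm_cyclicBad_eq_zero K H d
    (fun v hv => (hdeg v hv).trans (Set.ncard_le_ncard fun x hx => ⟨hKH v hv x hx.2 hx.1, hx.2⟩)) l₀
    (fun x hx => (hl₀ x).2 (Or.inr hx)) (by omega) (by
      rw [cyclicBad, Nat.add_eq_zero_iff, badPairs_eq_zero_iff, linkCost_eq_zero_iff]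
      constructor
      · show List.IsChain _ (w :: (t :: (((f.erase s).erase t).toList ++ [s])))
        rw [List.isChain_cons_cons]
        refine ⟨Or.inl hKt, List.Pairwise.isChain (List.pairwise_of_forall_mem_list ?_)⟩
        have hin : ∀ x ∈ t :: (((f.erase s).erase t).toList ++ [s]), x ∈ H := by
          intro x hx
          simp only [f, List.mem_cons, List.mem_append, Finset.mem_toList, Finset.mem_erase,
            Set.Finite.mem_toFinset, List.not_mem_nil, or_false] at hx
          rcases hx with rfl | h | rfl
          exacts [ht, h.2.2, hs]
        exact fun x hx y hy => Or.inr ⟨hin x hx, hin y hy⟩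
      · intro x hx y hy
        have h1 : x = s := by
          rw [show l₀ = (w :: t :: ((f.erase s).erase t).toList) ++ [s] from rfl,
            List.getLast?_concat] at hx
          exact (Option.some_inj.1 hx).symm
        have h2 : y = w := by simpa [l₀] using hy.symm
        rw [h1, h2]
        exact Or.inl hKs.symm)
  obtain ⟨m₁, m₂, rfl⟩ := List.append_of_mem (hm.mem_iff.2 ((hl₀ w).2 (Or.inl rfl)))
  rw [cyclicBad_append_comm] at hm0
  have hp : (w :: (m₂ ++ m₁)).Perm l₀ := (List.perm_append_comm (l₁ := w :: m₂)).trans hm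
  have hnd := hp.nodup_iff.2 hnd₀
  rw [List.nodup_cons] at hnd
  rw [List.cons_append] at hm0
  generalize m₂ ++ m₁ = q at hm0 hp hnd
  have hq : ∀ x, x ∈ q ↔ x ∈ H := by
    intro x
    have := hp.mem_iff (a := x)
    rw [hl₀, List.mem_cons] at this
    constructor
    · intro h
      exact (this.1 (Or.inr h)).resolve_left (by rintro rfl; exact hnd.1 h)
    · intro h
      exact (this.2 (Or.inr h)).resolve_left (by rintro rfl; exact hw h)
  have hqne : q ≠ [] := List.ne_nil_of_mem ((hq s).2 hs)
  have hab : q.head hqne ≠ q.getLast hqne := by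
    intro h
    obtain ⟨a, q', rfl⟩ := List.exists_cons_of_ne_nil hqne
    rcases eq_or_ne q' [] with rfl | h'
    · have h1 := (hq s).2 hs
      have h2 := (hq t).2 ht
      rw [List.mem_singleton] at h1 h2
      exact hst (h1.trans h2.symm)
    · rw [List.head_cons, List.getLast_cons h'] at h
      exact (List.nodup_cons.1 hnd.2).1 (h ▸ List.getLast_mem h')
  rw [cyclicBad, Nat.add_eq_zero_iff, badPairs_eq_zero_iff, linkCost_eq_zero_iff,
    List.isChain_cons] at hm0
  have ha := hKw _ (hm0.1.1 _ (List.head?_eq_some_head hqne))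
  have hb := hKw _ (hm0.2 (q.getLast hqne)
    (by rw [List.getLast?_cons_of_ne_nil hqne, List.getLast?_eq_some_getLast hqne]; rfl) w rfl).symm
  have hchain : q.IsChain G.Adj := by
    refine hm0.1.2.imp_of_mem_imp fun {x y} hx hy h => hKG _ _ h ?_ ?_
    · rintro rfl; exact hnd.1 hx
    · rintro rfl; exact hnd.1 hy
  rcases ha with ha | ha
  · refine ⟨q.reverse, List.nodup_reverse.2 hnd.2, by simpa using hq, ?_, ?_, ?_⟩
    · rw [List.isChain_reverse]
      exact hchain.imp fun x y h => h.symm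
    · rw [List.head?_reverse, List.getLast?_eq_some_getLast hqne]
      rw [hb.resolve_left fun h => hab (ha.trans h.symm)]
    · rw [List.getLast?_reverse, List.head?_eq_some_head hqne, ha]
  · refine ⟨q, hnd.2, hq, hchain, ?_, ?_⟩
    · rw [List.head?_eq_some_head hqne, ha]
    · rw [List.getLast?_eq_some_getLast hqne, hb.resolve_right fun h => hab (ha.trans h.symm)]

/-- A path with both ends in `H`, all internal vertices outside `H` and at least one internal vertex
extends to a cycle through all vertices of `H`. -/
lemma exists_isCycle_of_path [Finite V] {H : Set V} {d : ℕ}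
    (hdeg : ∀ v ∈ H, d ≤ (G.neighborSet v ∩ H).ncard) (hcard : H.ncard + 1 ≤ 2 * d) {s t : V}
    (hs : s ∈ H) (ht : t ∈ H) (hst : s ≠ t) (q : G.Walk s t) (hq : q.IsPath)
    (hint : ∀ x ∈ q.support.tail.dropLast, x ∉ H) (hne : q.support.tail.dropLast ≠ []) :
    ∃ (v : V) (c : G.Walk v v), c.IsCycle ∧
      c.length = H.ncard + q.support.tail.dropLast.length := by
  classical
  have hsupp : q.support = s :: (q.support.tail.dropLast ++ [t]) := by
    have htl : q.support.tail ≠ [] := by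
      intro h
      rw [h] at hne
      simp at hne
    have hlast : q.support.tail.getLast htl = t := by
      rw [List.getLast_tail]
      exact q.getLast_support
    conv_lhs => rw [← SimpleGraph.Walk.cons_tail_support]
    congr 1
    have := List.dropLast_append_getLast htl
    rw [hlast] at this
    exact this.symm
  have hnd : q.support.Nodup := hq.support_nodup
  have hch := q.isChain_adj_support
  generalize q.support.tail.dropLast = I at *
  obtain ⟨w, hw⟩ := List.exists_mem_of_ne_nil I hne
  obtain ⟨l, hl, hmem, hc, hh, hlast⟩ := exists_spanning_path hdeg hcard hs ht hst (hint w hw)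
  rw [hsupp, List.nodup_cons, List.nodup_append] at hnd
  have hlne : l ≠ [] := by rintro rfl; simp at hh
  rw [hsupp, List.isChain_cons, List.isChain_append] at hch
  have h0 : cyclicBad G.Adj (I ++ l) = 0 := by
    rw [cyclicBad_append hne hlne, badPairs_eq_zero_iff.2 hch.2.1, badPairs_eq_zero_iff.2 hc]
    have h1 : linkCost G.Adj I l = 0 := by
      rw [linkCost_eq_zero_iff, hh]
      intro x hx y hy
      exact hch.2.2.2 x hx y hy
    have h2 : linkCost G.Adj l I = 0 := by
      rw [linkCost_eq_zero_iff, hlast]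
      intro x hx y hy
      obtain rfl : s = x := by simpa using hx
      exact hch.1 y (by rw [List.head?_append_of_ne_nil _ hne]; exact hy)
    rw [h1, h2]
  have hndl : (I ++ l).Nodup := by
    rw [List.nodup_append]
    refine ⟨hnd.2.1, hl, ?_⟩
    rintro a ha _ hb rfl
    exact hint a ha ((hmem a).1 hb)
  have hlen : l.length = H.ncard := by
    rw [← List.toFinset_card_of_nodup hl, ← Set.ncard_coe_finset]
    congr 1
    ext x
    simp [hmem]
  have h2 : 2 ≤ H.ncard := by
    rw [← Set.ncard_pair hst]
    exact Set.ncard_le_ncard (by rintro x (rfl | rfl) <;> assumption)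
  have hI := List.length_pos_iff.2 hne
  obtain ⟨v, c, hc, hcl⟩ := exists_isCycle_of_cyclicBad_eq_zero hndl
    (by rw [List.length_append]; omega) h0
  exact ⟨v, c, hc, by rw [hcl, List.length_append]; omega⟩

end Sufficiency

section PathSegments

variable {V : Type*} {G : SimpleGraph V}

lemma SimpleGraph.Walk.IsPath.isAcyclic_toSubgraph {a b : V} {W : G.Walk a b} (hW : W.IsPath) :
    W.toSubgraph.spanningCoe.IsAcyclic := by
  induction W with
  | nil =>
    intro v c hc
    cases c with
    | nil => exact hc.not_nil .nil
    | cons h _ => simp at h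
  | @cons u v w h p ih =>
    rw [SimpleGraph.Walk.cons_isPath_iff] at hW
    have hn : ¬ p.toSubgraph.spanningCoe.Reachable u v := by
      rintro ⟨q⟩
      cases q with
      | nil => exact hW.2 p.start_mem_support
      | cons hq _ => exact hW.2 ((p.mem_verts_toSubgraph).1 hq.fst_mem)
    refine ((ih hW.1).sup_edge_of_not_reachable hn).anti ?_
    intro x y hxy
    simp only [SimpleGraph.Subgraph.spanningCoe_adj, SimpleGraph.Walk.toSubgraph,
      SimpleGraph.Subgraph.sup_adj, SimpleGraph.subgraphOfAdj_adj] at hxy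
    rw [SimpleGraph.sup_adj, SimpleGraph.edge_adj]
    rcases hxy with hxy | hxy
    · have hne := h.ne
      rcases Sym2.eq_iff.1 hxy with ⟨rfl, rfl⟩ | ⟨rfl, rfl⟩
      · exact Or.inr ⟨Or.inl ⟨rfl, rfl⟩, hne⟩
      · exact Or.inr ⟨Or.inr ⟨rfl, rfl⟩, hne.symm⟩
    · exact Or.inl hxy

lemma SimpleGraph.Walk.IsPath.isLinearForest_toSubgraph {a b : V} {W : G.Walk a b}
    (hW : W.IsPath) : IsLinearForest W.toSubgraph.spanningCoe := by
  refine ⟨hW.isAcyclic_toSubgraph, fun v => ?_⟩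
  by_cases hv : v ∈ W.support
  · obtain ⟨j, rfl, hj⟩ := SimpleGraph.Walk.mem_support_iff_exists_getVert.1 hv
    have hsub : W.toSubgraph.spanningCoe.neighborSet (W.getVert j) ⊆
        {W.getVert (j - 1), W.getVert (j + 1)} := by
      intro y hy
      obtain ⟨i, hi, hlt⟩ := W.toSubgraph_adj_iff.1 hy
      rcases Sym2.eq_iff.1 hi with ⟨h1, h2⟩ | ⟨h1, h2⟩
      · have := hW.getVert_injOn (show i ≤ _ by lia) hj h1
        subst this
        exact Or.inr h2.symm
      · have := hW.getVert_injOn (show i + 1 ≤ _ by lia) hj h2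
        subst this
        exact Or.inl h1.symm
    refine (Set.ncard_le_ncard hsub (Set.toFinite _)).trans ?_
    exact (Set.ncard_insert_le _ _).trans (by rw [Set.ncard_singleton])
  · have : W.toSubgraph.spanningCoe.neighborSet v = ∅ := by
      ext y
      simp only [Set.mem_empty_iff_false, iff_false]
      intro hy
      exact hv (W.mem_verts_toSubgraph.1 (SimpleGraph.Subgraph.Adj.fst_mem hy))
    simp [this]

lemma IsLinearForest.anti [Finite V] {F F' : SimpleGraph V} (h : F ≤ F') (hF : IsLinearForest F') :
    IsLinearForest F :=
  ⟨hF.1.anti h, fun v => (Set.ncard_le_ncard fun _ hy => h hy).trans (hF.2 v)⟩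

lemma IsTwoTerminalSegment.isEndpoint {H : Set V} {P : PathIn G} (hP : IsTwoTerminalSegment G H P)
    {x : V} (hx : x ∈ P.verts) (hxH : x ∈ H) : P.IsEndpoint x := by
  by_contra hne
  rw [PathIn.IsEndpoint, not_or] at hne
  refine hP.2.2.2 x ?_ hxH
  have hx' : x ∈ P.walk.support.tail := by
    rw [PathIn.verts, Set.mem_ofPred_eq, ← SimpleGraph.Walk.cons_tail_support] at hx
    exact (List.mem_cons.1 hx).resolve_left hne.1
  have htl := List.ne_nil_of_mem hx'
  have hlast : P.walk.support.tail.getLast htl = P.last := by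
    rw [List.getLast_tail]
    exact P.walk.getLast_support
  have := List.dropLast_append_getLast htl
  rw [hlast] at this
  rw [← this, List.mem_append, List.mem_singleton] at hx'
  exact hx'.resolve_right hne.2

lemma exists_segments_of_isPath [Finite V] {H : Set V} : ∀ (n : ℕ) {a b : V} (W : G.Walk a b),
    W.length = n → W.IsPath → a ∈ H → b ∈ H →
    ∃ (r : ℕ) (P : Fin r → PathIn G), (∀ i, IsTwoTerminalSegment G H (P i)) ∧
      InternallyDisjoint P ∧ (∀ i, (P i).walk.toSubgraph ≤ W.toSubgraph) ∧
      (⋃ i, (P i).verts) \ H = {x | x ∈ W.support} \ H := by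
  classical
  intro n
  induction n using Nat.strong_induction_on with
  | _ n ih =>
  intro a b W hn hW ha hb
  cases W with
  | nil =>
    refine ⟨0, Fin.elim0, fun i => i.elim0, fun i => i.elim0, fun i => i.elim0, ?_⟩
    ext x
    simp only [Set.iUnion_of_empty, Set.mem_sdiff, Set.mem_empty_iff_false, false_and, false_iff,
      Set.mem_ofPred_eq, SimpleGraph.Walk.support_nil, List.mem_singleton, not_and, not_not]
    rintro rfl
    exact ha
  | @cons _ a' _ h p =>
    rw [SimpleGraph.Walk.length_cons] at hn
    by_cases ha' : a' ∈ H
    · obtain ⟨r, P, h1, h2, h3, h4⟩ := ih p.length (by omega) p rfl hW.of_cons ha' hb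
      refine ⟨r, P, h1, h2, fun i => (h3 i).trans le_sup_right, ?_⟩
      rw [h4]
      ext x
      simp only [Set.mem_sdiff, Set.mem_ofPred_eq, SimpleGraph.Walk.support_cons, List.mem_cons]
      constructor
      · exact fun h => ⟨Or.inr h.1, h.2⟩
      · rintro ⟨rfl | hx, hxH⟩
        exacts [absurd ha hxH, ⟨hx, hxH⟩]
    · obtain ⟨c, hcH, hc, hfirst⟩ := p.exists_mem_support_forall_mem_support_imp_eq
        H.toFinite.toFinset ⟨b, by simp [hb]⟩
      rw [Set.Finite.mem_toFinset] at hcH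
      have hsplit : ((SimpleGraph.Walk.cons h (p.takeUntil c hc)).append (p.dropUntil c hc)) =
          SimpleGraph.Walk.cons h p := by
        rw [SimpleGraph.Walk.cons_append, p.take_spec]
      have hlen := congrArg SimpleGraph.Walk.length hsplit
      have hsupp := congrArg SimpleGraph.Walk.support hsplit
      have hsub := congrArg SimpleGraph.Walk.toSubgraph hsplit
      rw [SimpleGraph.Walk.length_append, SimpleGraph.Walk.length_cons,
        SimpleGraph.Walk.length_cons] at hlen
      rw [SimpleGraph.Walk.support_append] at hsupp
      rw [SimpleGraph.Walk.toSubgraph_append] at hsub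
      have hnd := hW.support_nodup
      rw [← hsupp, List.nodup_append] at hnd
      have hQ : (SimpleGraph.Walk.cons h (p.takeUntil c hc)).IsPath :=
        SimpleGraph.Walk.IsPath.of_append_left (q := p.dropUntil c hc) (by rwa [hsplit])
      obtain ⟨r, P, h1, h2, h3, h4⟩ := ih (p.dropUntil c hc).length (by omega) _ rfl
        (hW.of_cons.dropUntil hc) hcH hb
      let Q : PathIn G := ⟨a, c, SimpleGraph.Walk.cons h (p.takeUntil c hc), hQ⟩
      have hQseg : IsTwoTerminalSegment G H Q := by
        refine ⟨?_, ha, hcH, ?_⟩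
        · have : (p.takeUntil c hc).length ≠ 0 := by
            intro h0
            exact ha' (SimpleGraph.Walk.eq_of_length_eq_zero h0 ▸ hcH)
          rw [SimpleGraph.Walk.length_support]
          simp only [Q, SimpleGraph.Walk.length_cons]
          omega
        · intro x hx hxH
          simp only [Q, PathIn.internals, SimpleGraph.Walk.support_cons, List.tail_cons,
            Set.mem_ofPred_eq] at hx
          have hxc := hfirst x (by simpa using hxH) (List.dropLast_subset _ hx)
          have hnd' := (hW.of_cons.takeUntil hc).support_nodup
          have hne := (p.takeUntil c hc).support_ne_nil
          have happ := List.dropLast_append_getLast hne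
          rw [SimpleGraph.Walk.getLast_support] at happ
          rw [← happ, List.nodup_append] at hnd'
          exact hnd'.2.2 x hx c (by simp) hxc
      have hQP : ∀ i x, x ∈ Q.verts → x ∈ (P i).verts → Q.IsEndpoint x ∧ (P i).IsEndpoint x := by
        intro i x hxQ hxP
        have hxW : x ∈ (p.dropUntil c hc).support :=
          (SimpleGraph.Walk.mem_verts_toSubgraph _).1
            ((h3 i).1 ((SimpleGraph.Walk.mem_verts_toSubgraph _).2 hxP))
        have hxc : x = c := by
          by_contra hne
          rw [← SimpleGraph.Walk.cons_tail_support, List.mem_cons] at hxW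
          exact hnd.2.2 x hxQ x (hxW.resolve_left hne) rfl
        subst hxc
        exact ⟨Or.inr rfl, (h1 i).isEndpoint hxP hcH⟩
      refine ⟨r + 1, Fin.cons Q P, ?_, ?_, ?_, ?_⟩
      · intro i
        refine Fin.cases hQseg h1 i
      · intro i j
        refine Fin.cases ?_ (fun i => ?_) i <;> refine Fin.cases ?_ (fun j => ?_) j
        · exact fun h => absurd rfl h
        · intro _ x hx hy
          exact hQP j x hx hy
        · intro _ x hx hy
          exact (hQP i x hy hx).symm
        · intro hij x hx hy
          exact h2 i j (fun h => hij (by rw [h])) x hx hy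
      · intro i
        rw [← hsub]
        exact Fin.cases le_sup_left (fun i => (h3 i).trans le_sup_right) i
      · have hU : (⋃ i, ((Fin.cons Q P : Fin (r + 1) → PathIn G) i).verts) =
            Q.verts ∪ ⋃ i, (P i).verts := by
          ext x
          simp [Set.mem_iUnion, Fin.exists_fin_succ]
        rw [hU, Set.union_sdiff_distrib, h4, ← hsupp]
        ext x
        have hce : x ∈ (p.dropUntil c hc).support ↔
            x = c ∨ x ∈ (p.dropUntil c hc).support.tail := by
          conv_lhs => rw [← SimpleGraph.Walk.cons_tail_support, List.mem_cons]
        simp only [Set.mem_union, Set.mem_sdiff, Set.mem_ofPred_eq, List.mem_append, hce,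
          PathIn.verts, Q]
        constructor
        · rintro (⟨hx, hxH⟩ | ⟨rfl | hx, hxH⟩)
          exacts [⟨Or.inl hx, hxH⟩, absurd hcH hxH, ⟨Or.inr hx, hxH⟩]
        · rintro ⟨hx | hx, hxH⟩
          exacts [Or.inl ⟨hx, hxH⟩, Or.inr ⟨Or.inr hx, hxH⟩]

open Classical in
/-- A path with both ends in `H` decomposes into a system of `H`-segments. -/
lemma exists_isSegmentSystem_of_isChain [Finite V] {H : Set V} {M : List V} (hnd : M.Nodup)
    (hch : M.IsChain G.Adj) (hne : M ≠ []) (hhead : M.head hne ∈ H) (hlast : M.getLast hne ∈ H) :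
    ∃ (r : ℕ) (P : Fin r → PathIn G), IsSegmentSystem G H P ∧
      outsideCount H P = M.countP (· ∉ H) := by
  have hW : (SimpleGraph.Walk.ofSupport M hne hch).IsPath := by
    rw [SimpleGraph.Walk.isPath_def, SimpleGraph.Walk.support_ofSupport]
    exact hnd
  obtain ⟨r, P, h1, h2, h3, h4⟩ := exists_segments_of_isPath _ _ rfl hW hhead hlast
  refine ⟨r, P, ⟨h1, h2, hW.isLinearForest_toSubgraph.anti ?_⟩, ?_⟩
  · intro x y hxy
    obtain ⟨i, hi⟩ := segUnionGraph_adj.1 hxy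
    exact (h3 i).2 hi
  · rw [outsideCount, h4, SimpleGraph.Walk.support_ofSupport, List.countP_eq_length_filter,
      ← List.toFinset_card_of_nodup (hnd.filter _), ← Set.ncard_coe_finset]
    congr 1
    ext x
    simp

end PathSegments

section Necessity

variable {V : Type*} {G : SimpleGraph V}

lemma exists_path_of_isChain {H : Set V} {s t : V} {I : List V} {p : ℕ}
    (hnd : (s :: (I ++ [t])).Nodup) (hch : (s :: (I ++ [t])).IsChain G.Adj) (hs : s ∈ H)
    (ht : t ∈ H) (hI : ∀ x ∈ I, x ∉ H) (hp : p ≤ I.length) :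
    ∃ s ∈ H, ∃ t ∈ H, s ≠ t ∧ ∃ q : G.Walk s t, q.IsPath ∧
      (∀ x ∈ q.support.tail.dropLast, x ∉ H) ∧ p ≤ q.support.tail.dropLast.length := by
  let q : G.Walk s t := (SimpleGraph.Walk.ofSupport _ (by simp) hch).copy rfl (by simp)
  have hq : q.support = s :: (I ++ [t]) :=
    (SimpleGraph.Walk.support_copy ..).trans (SimpleGraph.Walk.support_ofSupport ..)
  refine ⟨s, hs, t, ht, ?_, q, ?_, ?_, ?_⟩
  · rintro rfl
    simp at hnd
  · rw [SimpleGraph.Walk.isPath_def, hq]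
    exact hnd
  · rw [hq, List.tail_cons, List.dropLast_concat]
    exact hI
  · rw [hq, List.tail_cons, List.dropLast_concat]
    exact hp

open Classical in
/-- Scanning a list that starts and ends in `H`, one meets either a run of at least `p` vertices
outside `H` or an initial part with a moderate number of vertices outside `H`. -/
lemma exists_long_run_or_initial_part {H : Set V} {p : ℕ} (hp : 1 ≤ p) : ∀ (Z Y : List V) (s : V)
    (I : List V), s ∈ H → (∀ x ∈ I, x ∉ H) → Y.countP (· ∉ H) < p →
    2 * p - 1 ≤ (Y ++ s :: (I ++ Z)).countP (· ∉ H) → (∀ x ∈ (s :: (I ++ Z)).getLast?, x ∈ H) →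
    (∃ Y' s' I' z Z', Y ++ s :: (I ++ Z) = Y' ++ s' :: (I' ++ z :: Z') ∧ s' ∈ H ∧ z ∈ H ∧
      (∀ x ∈ I', x ∉ H) ∧ p ≤ I'.length) ∨
    ∃ Y' z Z', Y ++ s :: (I ++ Z) = Y' ++ z :: Z' ∧ z ∈ H ∧ p ≤ Y'.countP (· ∉ H) ∧
      Y'.countP (· ∉ H) ≤ 2 * p - 2 := by
  intro Z
  induction Z with
  | nil =>
    intro Y s I hs hI hY hN hlast
    exfalso
    have hI0 : I = [] := by
      by_contra hne
      rw [List.append_nil, List.getLast?_cons_of_ne_nil hne, List.getLast?_eq_some_getLast hne]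
        at hlast
      exact hI _ (List.getLast_mem hne) (hlast _ rfl)
    subst hI0
    rw [List.nil_append, List.countP_append, List.countP_singleton] at hN
    simp only [hs, not_true, decide_false, Bool.false_eq_true, if_false, add_zero] at hN
    omega
  | cons z Z ih =>
    intro Y s I hs hI hY hN hlast
    by_cases hz : z ∈ H
    · by_cases hpI : p ≤ I.length
      · exact Or.inl ⟨Y, s, I, z, Z, rfl, hs, hz, hI, hpI⟩
      · have hcI : I.countP (· ∉ H) = I.length := List.countP_eq_length.2 (by simpa using hI)
        have hc : (Y ++ s :: I).countP (· ∉ H) = Y.countP (· ∉ H) + I.length := by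
          rw [List.countP_append, List.countP_cons, hcI]
          simp [hs]
        have e : Y ++ s :: (I ++ z :: Z) = (Y ++ s :: I) ++ z :: ([] ++ Z) := by simp
        by_cases hlt : (Y ++ s :: I).countP (· ∉ H) < p
        · have := ih (Y ++ s :: I) z [] hz (by simp) hlt (by rwa [← e]) (by
            rw [← List.cons_append, List.getLast?_append_of_ne_nil _ (by simp)] at hlast
            exact hlast)
          rwa [← e] at this
        · exact Or.inr ⟨Y ++ s :: I, z, Z, by simp, hz, by omega, by omega⟩
    · have e : I ++ z :: Z = (I ++ [z]) ++ Z := by simp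
      have := ih Y s (I ++ [z]) hs
        (by
          intro x hx
          rcases List.mem_append.1 hx with hx | hx
          · exact hI x hx
          · rw [List.mem_singleton.1 hx]
            exact hz) hY (by rwa [← e]) (by rwa [← e])
      rwa [← e] at this

open Classical in
/-- A cycle meeting `H` at least twice and having enough vertices outside `H` yields a long path
between vertices of `H` or a system of `H`-segments. -/
lemma exists_path_or_segments_of_two_le [Finite V] {H : Set V} {p : ℕ} (hp : 1 ≤ p) {L : List V}
    (hnd : L.Nodup) (hL : cyclicBad G.Adj L = 0) (hlen : 4 * p ≤ L.length)
    (hH : 2 ≤ L.countP (· ∈ H)) (hN : p ≤ L.countP (· ∉ H)) :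
    (∃ s ∈ H, ∃ t ∈ H, s ≠ t ∧ ∃ q : G.Walk s t, q.IsPath ∧
        (∀ x ∈ q.support.tail.dropLast, x ∉ H) ∧ p ≤ q.support.tail.dropLast.length) ∨
    (∃ (r : ℕ) (P : Fin r → PathIn G), IsSegmentSystem G H P ∧
        p ≤ outsideCount H P ∧ outsideCount H P ≤ 2 * p - 2) := by
  have hsum : L.length = L.countP (· ∈ H) + L.countP (· ∉ H) := by
    rw [List.length_eq_countP_add_countP (fun x => decide (x ∈ H))]
    simp
  by_cases hN2 : L.countP (· ∉ H) ≤ 2 * p - 2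
  · right
    have hne : L ≠ [] := by rintro rfl; simp at hH
    have h1 : L.countP (· ∈ H) ≤ L.dropLast.countP (· ∈ H) + 1 := by
      conv_lhs => rw [← List.dropLast_append_getLast hne, List.countP_append]
      gcongr
      exact List.countP_le_length
    have h2 : L.countP (· ∈ H) ≤ L.tail.countP (· ∈ H) + 1 := by
      conv_lhs => rw [← List.cons_head_tail hne, List.countP_cons]
      gcongr
      split_ifs <;> simp
    obtain ⟨l₁, x, y, l₂, rfl, hx, hy⟩ := exists_split_of_lt_countP (· ∈ H) (· ∈ H) L
      (by omega) hne
    have hperm : (y :: l₂ ++ (l₁ ++ [x])).Perm (l₁ ++ x :: y :: l₂) := by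
      rw [show l₁ ++ x :: y :: l₂ = (l₁ ++ [x]) ++ (y :: l₂) by simp]
      exact List.perm_append_comm
    rw [show l₁ ++ x :: y :: l₂ = (l₁ ++ [x]) ++ (y :: l₂) by simp, cyclicBad_append_comm,
      cyclicBad, Nat.add_eq_zero_iff, badPairs_eq_zero_iff] at hL
    obtain ⟨r, P, hP, hc⟩ := exists_isSegmentSystem_of_isChain (H := H) (hperm.nodup_iff.2 hnd) hL.1
      (by simp) (by simpa using hy) (by
        rw [List.getLast_append_of_ne_nil _ (by simp), List.getLast_append_of_ne_nil _ (by simp)]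
        simpa using hx)
    refine ⟨r, P, hP, ?_⟩
    rw [hc, hperm.countP_eq]
    exact ⟨hN, hN2⟩
  · obtain ⟨h₀, hmem, hh₀⟩ := List.countP_pos_iff.1 (show 0 < L.countP (· ∈ H) by omega)
    obtain ⟨A, B, rfl⟩ := List.append_of_mem hmem
    rw [cyclicBad_append_comm] at hL
    have hperm : (h₀ :: (B ++ A)).Perm (A ++ h₀ :: B) := List.perm_append_comm (l₁ := h₀ :: B)
    rw [← hperm.nodup_iff] at hnd
    rw [← hperm.countP_eq] at hH hN2
    rw [List.cons_append] at hL
    clear hperm hsum hN hmem hlen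
    generalize B ++ A = L at *
    have hh : h₀ ∈ H := by simpa using hh₀
    rw [cyclicBad, Nat.add_eq_zero_iff, badPairs_eq_zero_iff, linkCost_eq_zero_iff] at hL
    have hX : ((h₀ :: L) ++ [h₀]).IsChain G.Adj := by
      rw [List.isChain_append]
      exact ⟨hL.1, by simp, by simpa using hL.2⟩
    have hNX : ((h₀ :: L) ++ [h₀]).countP (· ∉ H) = (h₀ :: L).countP (· ∉ H) := by
      rw [List.countP_append]
      simp [hh]
    rcases exists_long_run_or_initial_part hp (L ++ [h₀]) [] h₀ [] hh (by simp)
      (by rw [List.countP_nil]; omega)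
      (by
        rw [List.nil_append, List.nil_append, ← List.cons_append, hNX]
        omega)
      (by
        intro x hx
        rw [List.nil_append, ← List.cons_append, List.getLast?_concat] at hx
        exact (Option.some_inj.1 hx) ▸ hh) with
      ⟨Y, s, I, z, Z, e, hs, hz, hI, hpI⟩ | ⟨Y, z, Z, e, hz, h1, h2⟩
    · left
      rw [List.nil_append, List.nil_append, ← List.cons_append] at e
      have hinf : s :: (I ++ [z]) <:+: (h₀ :: L) ++ [h₀] := ⟨Y, Z, by rw [e]; simp⟩
      refine exists_path_of_isChain ?_ (isChain_of_isInfix hinf hX) hs hz hI hpI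
      rcases List.eq_nil_or_concat Z with rfl | ⟨Z, w, rfl⟩
      · have e' : h₀ :: L ++ [h₀] = (Y ++ s :: I) ++ [z] := by rw [e]; simp
        obtain ⟨e1, e2⟩ := List.append_inj' e' rfl
        obtain rfl : h₀ = z := by simpa using e2
        cases Y with
        | nil =>
          exfalso
          rw [e1, List.nil_append, List.countP_cons,
            List.countP_eq_zero.2 (by simpa using hI)] at hH
          split_ifs at hH <;> omega
        | cons y Y =>
          rw [List.cons_append, List.cons.injEq] at e1
          obtain ⟨rfl, rfl⟩ := e1
          have : (s :: I).Nodup := (List.nodup_append.1 (List.nodup_cons.1 hnd).2).2.1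
          have h2 : h₀ ∉ s :: I := fun h => (List.nodup_cons.1 hnd).1 (List.mem_append_right _ h)
          rw [← List.cons_append, List.nodup_append]
          refine ⟨this, by simp, ?_⟩
          rintro a ha b hb rfl
          exact h2 (List.mem_singleton.1 hb ▸ ha)
      · have e' : h₀ :: L ++ [h₀] = (Y ++ s :: (I ++ z :: Z)) ++ [w] := by rw [e]; simp
        obtain ⟨e1, -⟩ := List.append_inj' e' rfl
        have hinf : s :: (I ++ [z]) <:+: h₀ :: L := ⟨Y, Z, by rw [e1]; simp⟩
        exact hinf.sublist.nodup hnd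
    · right
      rw [List.nil_append, List.nil_append, ← List.cons_append] at e
      rcases List.eq_nil_or_concat Z with rfl | ⟨Z, w, rfl⟩
      · obtain ⟨e1, -⟩ := List.append_inj' e rfl
        rw [e1] at hN2
        omega
      · have e' : h₀ :: L ++ [h₀] = (Y ++ z :: Z) ++ [w] := by rw [e]; simp
        obtain ⟨e1, -⟩ := List.append_inj' e' rfl
        have hpre : Y ++ [z] <+: h₀ :: L := ⟨Z, by rw [e1]; simp⟩
        cases Y with
        | nil => simp at h1; omega
        | cons y Y =>
          rw [List.cons_append, List.cons.injEq] at e1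
          obtain ⟨r, P, hP, hc⟩ := exists_isSegmentSystem_of_isChain (H := H)
            (hpre.sublist.nodup hnd) (isChain_of_isInfix hpre.isInfix hL.1) (by simp) (e1.1 ▸ hh)
            (by simpa using hz)
          refine ⟨r, P, hP, ?_⟩
          rw [hc, List.countP_append]
          simp only [List.countP_singleton, hz, not_true, decide_false, Bool.false_eq_true,
            if_false, add_zero]
          exact ⟨h1, h2⟩

end Necessity

section Links

variable {V : Type*} {G : SimpleGraph V}

/-- The list `l ++ [b]` is a path from `A` to `B` whose only vertex in `B` is `b`. -/
structure IsLink (G : SimpleGraph V) (A B : Set V) (l : List V) (b : V) : Prop where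
  chain : (l ++ [b]).IsChain G.Adj
  nodup : (l ++ [b]).Nodup
  head_mem : ∀ x ∈ (l ++ [b]).head?, x ∈ A
  last_mem : b ∈ B
  not_mem : ∀ x ∈ l, x ∉ B

lemma exists_eq_append_cons_of_exists_mem {p : V → Prop} {l : List V} (h : ∃ x ∈ l, p x) :
    ∃ l₁ x l₂, l = l₁ ++ x :: l₂ ∧ p x ∧ ∀ y ∈ l₁, ¬ p y := by
  classical
  obtain ⟨x, hx⟩ := Option.isSome_iff_exists.1
    (List.find?_isSome (p := fun x => decide (p x)).2 (by simpa using h))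
  obtain ⟨h1, l₁, l₂, h2, h3⟩ := List.find?_eq_some_iff_append.1 hx
  exact ⟨l₁, x, l₂, h2, by simpa using h1, by simpa using h3⟩

lemma exists_eq_append_cons_of_exists_mem' {p : V → Prop} {l : List V} (h : ∃ x ∈ l, p x) :
    ∃ l₁ x l₂, l = l₁ ++ x :: l₂ ∧ p x ∧ ∀ y ∈ l₂, ¬ p y := by
  obtain ⟨l₁, x, l₂, h1, h2, h3⟩ := exists_eq_append_cons_of_exists_mem (l := l.reverse) (p := p)
    (by simpa using h)
  refine ⟨l₂.reverse, x, l₁.reverse, ?_, h2, by simpa using h3⟩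
  rw [← List.reverse_reverse l, h1]
  simp

lemma exists_isLink {A B : Set V} {l : List V} (hch : l.IsChain G.Adj) (hnd : l.Nodup)
    (hA : ∀ x ∈ l.head?, x ∈ A) (hB : ∃ x ∈ l, x ∈ B) :
    ∃ m b, IsLink G A B m b ∧ m ++ [b] <+: l := by
  obtain ⟨m, b, m', rfl, hb, hm⟩ := exists_eq_append_cons_of_exists_mem hB
  have hpre : m ++ [b] <+: m ++ b :: m' := ⟨m', by simp⟩
  refine ⟨m, b, ⟨isChain_of_isInfix hpre.isInfix hch, hpre.sublist.nodup hnd, ?_, hb, hm⟩, hpre⟩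
  rw [show m ++ b :: m' = (m ++ [b]) ++ m' by simp, List.head?_append_of_ne_nil _ (by simp)] at hA
  exact hA

lemma IsLink.append {A B B' : Set V} {W D : List V} {y c : V} (h : IsLink G A B' W y)
    (hch : (y :: D ++ [c]).IsChain G.Adj) (hnd : (y :: D ++ [c]).Nodup)
    (hB' : ∀ z ∈ y :: D ++ [c], z ∈ B') (hBB' : B ⊆ B') (hc : c ∈ B) (hD : ∀ z ∈ y :: D, z ∉ B) :
    IsLink G A B (W ++ y :: D) c := by
  refine ⟨?_, ?_, ?_, hc, ?_⟩
  · rw [List.append_assoc, List.cons_append, List.isChain_split]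
    exact ⟨h.chain, hch⟩
  · rw [List.append_assoc, List.nodup_append]
    refine ⟨(List.nodup_append.1 h.nodup).1, hnd, ?_⟩
    rintro a ha _ hb rfl
    exact h.not_mem a ha (hB' a hb)
  · have := h.head_mem
    cases W <;> simpa using this
  · intro x hx
    rcases List.mem_append.1 hx with hx | hx
    · exact fun hxB => h.not_mem x hx (hBB' hxB)
    · exact hD x hx

/-- **Menger's theorem** for two paths: if no single vertex separates `A` from `B`, then there are
two disjoint links, one of which has the same end as a given one. -/
lemma exists_disjoint_isLink {A : Set V} : ∀ (n : ℕ) (B : Set V) (P : List V) (b : V),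
    P.length = n → IsLink G A B P b →
    (∀ v, ∃ l c, IsLink G A B l c ∧ v ∉ l ++ [c]) →
    ∃ W₁ W₂ y, IsLink G A B W₁ b ∧ IsLink G A B W₂ y ∧ (W₁ ++ [b]).Disjoint (W₂ ++ [y]) := by
  intro n
  induction n using Nat.strong_induction_on with
  | _ n ih =>
  intro B P b hn hP hsep
  obtain ⟨R, r, hR, hb⟩ := hsep b
  have hrP : r ∉ P := fun h => hP.not_mem r h hR.last_mem
  rw [List.mem_append, List.mem_singleton, not_or] at hb
  by_cases hx : ∃ x ∈ R, x ∈ P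
  · obtain ⟨R₁, x, R₂, rfl, hxP, hR₂⟩ := exists_eq_append_cons_of_exists_mem' hx
    obtain ⟨P₁, P₂, rfl⟩ := List.append_of_mem hxP
    have hPinf : x :: P₂ ++ [b] <:+: P₁ ++ x :: P₂ ++ [b] := ⟨P₁, [], by simp⟩
    have hRinf : x :: R₂ ++ [r] <:+: R₁ ++ x :: R₂ ++ [r] := ⟨R₁, [], by simp⟩
    have hPc := isChain_of_isInfix hPinf hP.chain
    have hPn := hPinf.sublist.nodup hP.nodup
    have hRc := isChain_of_isInfix hRinf hR.chain
    have hRn := hRinf.sublist.nodup hR.nodup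
    have hPB := hP.not_mem
    have hRB := hR.not_mem
    have hbB := hP.last_mem
    have hrB := hR.last_mem
    have hPnd := hP.nodup
    have hPR : (x :: P₂ ++ [b]).Disjoint (R₂ ++ [r]) := by
      clear ih hsep hn hPc hRc hP hR hPinf hRinf
      intro z
      grind
    have hRP : (x :: R₂ ++ [r]).Disjoint (P₂ ++ [b]) := by
      clear ih hsep hn hPc hRc hP hR hPinf hRinf
      intro z
      grind
    have hP₁n : ∀ z ∈ P₁, z ∉ B ∧ z ∉ P₂ ∧ z ∉ R₂ ∧ z ≠ x := by
      clear ih hsep hn hPc hRc hP hR hPinf hRinf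
      grind
    have hPD : ∀ z ∈ x :: P₂, z ∉ B := fun z hz => hPB z (List.mem_append_right _ hz)
    have hRD : ∀ z ∈ x :: R₂, z ∉ B := fun z hz => hRB z (List.mem_append_right _ hz)
    let B' : Set V := {z | z ∈ B ∨ z ∈ P₂ ∨ z ∈ R₂ ∨ z = x}
    have hBB' : B ⊆ B' := fun z hz => Or.inl hz
    have hPB' : ∀ z ∈ x :: P₂ ++ [b], z ∈ B' := by
      intro z hz
      simp only [List.mem_append, List.mem_cons, List.not_mem_nil, or_false] at hz
      rcases hz with (rfl | hz) | rfl <;> simp [B', *]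
    have hRB' : ∀ z ∈ x :: R₂ ++ [r], z ∈ B' := by
      intro z hz
      simp only [List.mem_append, List.mem_cons, List.not_mem_nil, or_false] at hz
      rcases hz with (rfl | hz) | rfl <;> simp [B', *]
    have hdis : ∀ {W₁ W₂ E₁ E₂ : List V}, W₁.Disjoint W₂ → (∀ z ∈ W₁, z ∉ B') →
        (∀ z ∈ W₂, z ∉ B') → (∀ z ∈ E₁, z ∈ B') → (∀ z ∈ E₂, z ∈ B') → E₁.Disjoint E₂ →
        (W₁ ++ E₁).Disjoint (W₂ ++ E₂) := by
      intro W₁ W₂ E₁ E₂ h1 h2 h3 h4 h5 h6 z hz hz'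
      rw [List.mem_append] at hz hz'
      rcases hz with hz | hz <;> rcases hz' with hz' | hz'
      exacts [h1 hz hz', h2 z hz (h5 z hz'), h3 z hz' (h4 z hz), h6 hz hz']
    have hP₁ : IsLink G A B' P₁ x := by
      have hpre : P₁ ++ [x] <+: P₁ ++ x :: P₂ ++ [b] := ⟨P₂ ++ [b], by simp⟩
      refine ⟨isChain_of_isInfix hpre.isInfix hP.chain, hpre.sublist.nodup hP.nodup, ?_,
        hPB' x (by simp), ?_⟩
      · have := hP.head_mem
        cases P₁ <;> simpa using this
      · intro z hz
        simpa [B'] using hP₁n z hz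
    obtain ⟨W₁, W₂, y, hW₁, hW₂, hW⟩ := ih P₁.length (by rw [← hn]; simp) B' P₁ x rfl hP₁ (by
      intro v
      obtain ⟨l, c, hl, hv⟩ := hsep v
      obtain ⟨m, e, hm, hpre⟩ := exists_isLink (B := B') hl.chain hl.nodup hl.head_mem
        ⟨c, by simp, hBB' hl.last_mem⟩
      exact ⟨m, e, hm, fun h => hv (hpre.subset h)⟩)
    have hWW : W₁.Disjoint W₂ := fun z h1 h2 =>
      hW (List.mem_append_left _ h1) (List.mem_append_left _ h2)
    have hyx : y ≠ x := by
      rintro rfl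
      exact hW (a := y) (by simp) (by simp)
    have hxR : IsLink G A B (W₁ ++ x :: R₂) r :=
      hW₁.append hRc hRn hRB' hBB' hrB hRD
    have hxP : IsLink G A B (W₁ ++ x :: P₂) b :=
      hW₁.append hPc hPn hPB' hBB' hbB hPD
    by_cases hyP : y ∈ P₂
    · obtain ⟨U, T, rfl⟩ := List.append_of_mem hyP
      have hinf : y :: T ++ [b] <:+: x :: (U ++ y :: T) ++ [b] := ⟨x :: U, [], by simp⟩
      have hsub : y :: T ++ [b] ⊆ U ++ y :: T ++ [b] := by simp
      refine ⟨W₂ ++ y :: T, W₁ ++ x :: R₂, r,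
        hW₂.append (isChain_of_isInfix hinf hPc) (hinf.sublist.nodup hPn)
          (fun z hz => hPB' z (hinf.subset hz)) hBB' hbB
          (fun z hz => hPD z (List.mem_cons_of_mem _ (List.mem_append_right _ hz))), hxR, ?_⟩
      rw [List.append_assoc, List.append_assoc]
      exact hdis hWW.symm hW₂.not_mem hW₁.not_mem (fun z hz => hPB' z (hinf.subset hz)) hRB'
        fun z hz hz' => hRP hz' (hsub hz)
    by_cases hyR : y ∈ R₂
    · obtain ⟨U, T, rfl⟩ := List.append_of_mem hyR
      have hinf : y :: T ++ [r] <:+: x :: (U ++ y :: T) ++ [r] := ⟨x :: U, [], by simp⟩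
      have hsub : y :: T ++ [r] ⊆ U ++ y :: T ++ [r] := by simp
      refine ⟨W₁ ++ x :: P₂, W₂ ++ y :: T, r, hxP,
        hW₂.append (isChain_of_isInfix hinf hRc) (hinf.sublist.nodup hRn)
          (fun z hz => hRB' z (hinf.subset hz)) hBB' hrB
          (fun z hz => hRD z (List.mem_cons_of_mem _ (List.mem_append_right _ hz))), ?_⟩
      rw [List.append_assoc, List.append_assoc]
      exact hdis hWW hW₁.not_mem hW₂.not_mem hPB' (fun z hz => hRB' z (hinf.subset hz))
        fun z hz hz' => hPR hz (hsub hz')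
    have hyB : y ∈ B := by
      have := hW₂.last_mem
      simp only [B', Set.mem_ofPred_eq] at this
      tauto
    have hW₂B : IsLink G A B W₂ y :=
      ⟨hW₂.chain, hW₂.nodup, hW₂.head_mem, hyB, fun z hz h => hW₂.not_mem z hz (hBB' h)⟩
    by_cases hyb : y = b
    · subst hyb
      refine ⟨W₂, W₁ ++ x :: R₂, r, hW₂B, hxR, ?_⟩
      rw [List.append_assoc]
      refine hdis hWW.symm hW₂.not_mem hW₁.not_mem (by simpa using hBB' hyB) hRB'
        fun z hz hz' => hRP hz' (List.mem_append_right _ hz)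
    · refine ⟨W₁ ++ x :: P₂, W₂, y, hxP, hW₂B, ?_⟩
      rw [List.append_assoc]
      refine hdis hWW hW₁.not_mem hW₂.not_mem hPB' (by simpa using hBB' hyB) ?_
      intro z hz hz'
      obtain rfl := List.mem_singleton.1 hz'
      rcases List.mem_append.1 hz with hz | hz
      exacts [hPD z hz hyB, hyb (List.mem_singleton.1 hz)]
  · refine ⟨P, R, r, hP, hR, ?_⟩
    clear ih hsep hP hR
    intro z
    grind

end Links

section FewCommon

variable {V : Type*} {G : SimpleGraph V}

lemma IsLink.exists_suffix {A B C : Set V} {W : List V} {b : V} (h : IsLink G A B W b)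
    (hC : ∃ x ∈ W ++ [b], x ∈ C) :
    ∃ a D S, a :: D = S ++ [b] ∧ S ++ [b] <:+ W ++ [b] ∧ a ∈ C ∧ (∀ x ∈ D, x ∉ C) ∧
      ∀ x ∈ S, x ∉ B := by
  obtain ⟨l, a, D, h1, ha, hD⟩ := exists_eq_append_cons_of_exists_mem' hC
  obtain ⟨S, e, hS⟩ : ∃ S e, a :: D = S ++ [e] :=
    ⟨_, _, (List.dropLast_append_getLast (List.cons_ne_nil a D)).symm⟩
  rw [hS, ← List.append_assoc] at h1
  obtain ⟨h2, h3⟩ := List.append_inj' h1 rfl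
  obtain rfl : b = e := by simpa using h3
  refine ⟨a, D, S, hS, ⟨l, by rw [h2, List.append_assoc]⟩, ha, hD, fun x hx => ?_⟩
  exact h.not_mem x (h2 ▸ List.mem_append_right _ hx)

lemma exists_path_of_arc {H A : Set V} {p : ℕ} {a₁ a₂ b₁ b₂ : V} {D₁ D₂ S₁ S₂ X : List V}
    (h₁ : a₁ :: D₁ = S₁ ++ [b₁]) (h₂ : a₂ :: D₂ = S₂ ++ [b₂])
    (hc₁ : (S₁ ++ [b₁]).IsChain G.Adj) (hc₂ : (S₂ ++ [b₂]).IsChain G.Adj)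
    (hn₁ : (S₁ ++ [b₁]).Nodup) (hn₂ : (S₂ ++ [b₂]).Nodup)
    (hdis : (S₁ ++ [b₁]).Disjoint (S₂ ++ [b₂])) (hD₁ : ∀ x ∈ D₁, x ∉ A) (hD₂ : ∀ x ∈ D₂, x ∉ A)
    (hS₁ : ∀ x ∈ S₁, x ∉ H) (hS₂ : ∀ x ∈ S₂, x ∉ H) (hb₁ : b₁ ∈ H) (hb₂ : b₂ ∈ H)
    (hX : (a₁ :: (X ++ [a₂])).IsChain G.Adj) (hXn : (a₁ :: (X ++ [a₂])).Nodup)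
    (hXA : ∀ x ∈ X, x ∈ A) (hXH : ∀ x ∈ X, x ∉ H) (hp : p ≤ X.length) :
    ∃ s ∈ H, ∃ t ∈ H, s ≠ t ∧ ∃ q : G.Walk s t, q.IsPath ∧
      (∀ x ∈ q.support.tail.dropLast, x ∉ H) ∧ p ≤ q.support.tail.dropLast.length := by
  have hr : b₁ :: S₁.reverse = D₁.reverse ++ [a₁] := by
    have := congrArg List.reverse h₁
    simpa using this.symm
  have e : b₁ :: ((S₁.reverse ++ X ++ S₂) ++ [b₂]) = (b₁ :: S₁.reverse) ++ (X ++ a₂ :: D₂) := by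
    rw [h₂]
    simp
  refine exists_path_of_isChain (s := b₁) (t := b₂) (I := S₁.reverse ++ X ++ S₂) ?_ ?_ hb₁ hb₂ ?_
    (by simp; omega)
  · rw [e, List.nodup_append]
    refine ⟨?_, ?_, ?_⟩
    · rw [← List.nodup_reverse]
      simpa using hn₁
    · rw [List.nodup_append]
      refine ⟨((List.nodup_cons.1 hXn).2.of_append_left), h₂ ▸ hn₂, ?_⟩
      rintro x hx y hy rfl
      rcases List.mem_cons.1 hy with rfl | hy
      · have := (List.nodup_cons.1 hXn).2
        rw [List.nodup_append] at this
        exact this.2.2 x hx x (by simp) rfl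
      · exact hD₂ x hy (hXA x hx)
    · rintro x hx y hy rfl
      have hx' : x ∈ S₁ ++ [b₁] := by
        rcases List.mem_cons.1 hx with rfl | hx
        · simp
        · exact List.mem_append_left _ (List.mem_reverse.1 hx)
      rcases List.mem_append.1 hy with hy | hy
      · rw [← h₁] at hx'
        rcases List.mem_cons.1 hx' with rfl | hx'
        · exact (List.nodup_cons.1 hXn).1 (List.mem_append_left _ hy)
        · exact hD₁ x hx' (hXA x hy)
      · exact hdis hx' (h₂ ▸ hy)
  · rw [e, hr, List.append_assoc, List.singleton_append, List.isChain_split]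
    refine ⟨?_, ?_⟩
    · rw [← hr, show b₁ :: S₁.reverse = (S₁ ++ [b₁]).reverse by simp, List.isChain_reverse]
      exact hc₁.imp fun _ _ h => h.symm
    · rw [← List.cons_append, List.isChain_split]
      exact ⟨hX, h₂ ▸ hc₂⟩
  · intro x hx
    rw [List.mem_append, List.mem_append, List.mem_reverse] at hx
    rcases hx with (hx | hx) | hx
    exacts [hS₁ x hx, hXH x hx, hS₂ x hx]

lemma exists_isLink_avoiding (h2c : ∀ v : V, (G.induce ({v}ᶜ : Set V)).Connected) {A B : Set V}
    (hA : A.Nontrivial) (hB : B.Nontrivial) (v : V) : ∃ l c, IsLink G A B l c ∧ v ∉ l ++ [c] := by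
  classical
  obtain ⟨a, ha, hav⟩ := hA.exists_ne v
  obtain ⟨b, hb, hbv⟩ := hB.exists_ne v
  obtain ⟨w, hw⟩ := ((h2c v).preconnected ⟨a, hav⟩ ⟨b, hbv⟩).some.toPath
  let q : G.Walk a b := w.map (SimpleGraph.Embedding.induce ({v}ᶜ : Set V)).toHom
  have hq : q.IsPath := hw.map Subtype.val_injective
  have hs : q.support = w.support.map Subtype.val := SimpleGraph.Walk.support_map ..
  have hv : v ∉ q.support := by
    rw [hs, List.mem_map]
    rintro ⟨x, -, hx⟩
    exact x.2 hx
  obtain ⟨m, c, hm, hpre⟩ := exists_isLink (A := A) (B := B) q.isChain_adj_support hq.support_nodup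
    (by simpa [List.head?_eq_some_head q.support_ne_nil] using ha) ⟨b, q.end_mem_support, hb⟩
  exact ⟨m, c, hm, fun h => hv (hpre.subset h)⟩

/-- A long cycle that meets `H` in at most one vertex yields a long path between vertices of `H`
avoiding the rest of `H`. -/
lemma exists_path_of_subsingleton (h2c : ∀ v : V, (G.induce ({v}ᶜ : Set V)).Connected)
    {H : Set V} (hH : H.Nontrivial) {p : ℕ} {L : List V} (hnd : L.Nodup)
    (hL : cyclicBad G.Adj L = 0) (hlen : 2 * p + 2 ≤ L.length)
    (hLH : ∀ x ∈ L, x ∈ H → ∀ y ∈ L, y ∈ H → x = y) :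
    ∃ s ∈ H, ∃ t ∈ H, s ≠ t ∧ ∃ q : G.Walk s t, q.IsPath ∧
      (∀ x ∈ q.support.tail.dropLast, x ∉ H) ∧ p ≤ q.support.tail.dropLast.length := by
  set A : Set V := {x | x ∈ L} with hAdef
  have hA : A.Nontrivial := by
    match L, hnd, hlen with
    | [], _, h => simp at h
    | [_], _, h => simp at h
    | x :: y :: l, h, _ =>
      refine ⟨x, by simp [hAdef], y, by simp [hAdef], ?_⟩
      rintro rfl
      simp at h
  have hsep := exists_isLink_avoiding h2c hA hH
  obtain ⟨P, b₁, hP, hPL⟩ : ∃ P b, IsLink G A H P b ∧ ∀ x ∈ L, x ∈ H → x = b := by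
    by_cases h : ∃ x ∈ L, x ∈ H
    · obtain ⟨x, hx, hxH⟩ := h
      exact ⟨[], x, ⟨by simp, by simp, by simpa [hAdef] using hx, hxH, by simp⟩,
        fun y hy hyH => hLH y hy hyH x hx hxH⟩
    · obtain ⟨v, -⟩ := hA.nonempty
      obtain ⟨l, c, hl, -⟩ := hsep v
      exact ⟨l, c, hl, fun x hx hxH => (h ⟨x, hx, hxH⟩).elim⟩
  obtain ⟨W₁, W₂, b₂, hW₁, hW₂, hW⟩ := exists_disjoint_isLink _ H P b₁ rfl hP hsep
  have hmeet : ∀ {W : List V} {b : V}, IsLink G A H W b → ∃ x ∈ W ++ [b], x ∈ A := by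
    intro W b h
    have := h.head_mem
    cases W <;> simp_all
  obtain ⟨a₁, D₁, S₁, h₁, hs₁, ha₁, hD₁, hS₁⟩ := hW₁.exists_suffix (hmeet hW₁)
  obtain ⟨a₂, D₂, S₂, h₂, hs₂, ha₂, hD₂, hS₂⟩ := hW₂.exists_suffix (hmeet hW₂)
  have hdis : (S₁ ++ [b₁]).Disjoint (S₂ ++ [b₂]) := fun x hx hx' =>
    hW (hs₁.subset hx) (hs₂.subset hx')
  have hne : a₂ ≠ a₁ := by
    rintro rfl
    exact hdis (a := a₂) (by simp [← h₁]) (by simp [← h₂])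
  have hLa : ∀ x ∈ L, x ≠ a₁ → x ∉ H := by
    intro x hx hxa hxH
    obtain rfl := hPL x hx hxH
    have : x ∈ a₁ :: D₁ := by simp [h₁]
    rcases List.mem_cons.1 this with h | h
    exacts [hxa h, hD₁ x h hx]
  obtain ⟨l, r, hlr⟩ := List.append_of_mem (show a₁ ∈ L from ha₁)
  obtain ⟨X, Y, hXY⟩ : ∃ X Y, r ++ l = X ++ a₂ :: Y := by
    refine List.append_of_mem ?_
    have : a₂ ∈ L := ha₂
    rw [hlr] at this
    simp only [List.mem_append, List.mem_cons, hne, false_or] at this ⊢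
    tauto
  have hperm : L.Perm (a₁ :: (X ++ a₂ :: Y)) := by
    rw [← hXY, hlr, ← List.cons_append]
    exact List.perm_append_comm
  have hcyc : cyclicBad G.Adj (a₁ :: X ++ a₂ :: Y) = 0 := by
    rw [List.cons_append, ← hXY, ← List.cons_append, cyclicBad_append_comm, ← hlr, hL]
  have hcyc' : cyclicBad G.Adj (a₂ :: Y ++ a₁ :: X) = 0 := by rwa [cyclicBad_append_comm]
  have hch : (a₁ :: X ++ a₂ :: Y).IsChain G.Adj := by
    rw [← badPairs_eq_zero_iff]
    unfold cyclicBad at hcyc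
    omega
  have hch' : (a₂ :: Y ++ a₁ :: X).IsChain G.Adj := by
    rw [← badPairs_eq_zero_iff]
    unfold cyclicBad at hcyc'
    omega
  have hnd₁ : (a₁ :: X ++ a₂ :: Y).Nodup := hperm.nodup_iff.1 hnd
  have hnd₂ : (a₂ :: Y ++ a₁ :: X).Nodup := (List.perm_append_comm.nodup_iff).1 hnd₁
  have hXL : ∀ x ∈ X, x ∈ L := fun x hx => hperm.mem_iff.2 (by simp [hx])
  have hYL : ∀ x ∈ Y, x ∈ L := fun x hx => hperm.mem_iff.2 (by simp [hx])
  have hXa : ∀ x ∈ X, x ≠ a₁ := by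
    rintro x hx rfl
    exact (List.nodup_cons.1 hnd₁).1 (List.mem_append_left _ hx)
  have hYa : ∀ x ∈ Y, x ≠ a₁ := by
    rintro x hx rfl
    exact (List.nodup_cons.1 hnd₁).1 (List.mem_append_right _ (List.mem_cons_of_mem _ hx))
  have hpX : a₁ :: (X ++ [a₂]) <+: a₁ :: X ++ a₂ :: Y := ⟨Y, by simp⟩
  have hpY : a₂ :: (Y ++ [a₁]) <+: a₂ :: Y ++ a₁ :: X := ⟨X, by simp⟩
  have hc₁ := hW₁.chain.suffix hs₁
  have hc₂ := hW₂.chain.suffix hs₂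
  have hn₁ := hs₁.sublist.nodup hW₁.nodup
  have hn₂ := hs₂.sublist.nodup hW₂.nodup
  have hlen' := hperm.length_eq
  simp only [List.length_cons, List.length_append] at hlen'
  rcases le_total p X.length with h | h
  · exact exists_path_of_arc h₁ h₂ hc₁ hc₂ hn₁ hn₂ hdis hD₁ hD₂ hS₁ hS₂ hW₁.last_mem hW₂.last_mem
      (isChain_of_isInfix hpX.isInfix hch) (hpX.sublist.nodup hnd₁) hXL
      (fun x hx => hLa x (hXL x hx) (hXa x hx)) h
  · exact exists_path_of_arc h₂ h₁ hc₂ hc₁ hn₂ hn₁ hdis.symm hD₂ hD₁ hS₂ hS₁ hW₂.last_mem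
      hW₁.last_mem (isChain_of_isInfix hpY.isInfix hch') (hpY.sublist.nodup hnd₂) hYL
      (fun x hx => hLa x (hYL x hx) (hYa x hx)) (by omega)

end FewCommon

section CycleLists

variable {V : Type*} {G : SimpleGraph V}

lemma exists_list_of_isCycle {v : V} {c : G.Walk v v} (hc : c.IsCycle) :
    ∃ L : List V, L.Nodup ∧ cyclicBad G.Adj L = 0 ∧ L.length = c.length := by
  cases c with
  | nil => simp at hc
  | cons h q =>
    refine ⟨q.support, ((SimpleGraph.Walk.cons_isCycle_iff q h).1 hc).1.support_nodup, ?_, by simp⟩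
    rw [cyclicBad, badPairs_eq_zero_iff.2 q.isChain_adj_support, linkCost_eq_zero_iff.2, add_zero]
    intro x hx y hy
    rw [List.getLast?_eq_some_getLast q.support_ne_nil] at hx
    rw [← SimpleGraph.Walk.cons_tail_support] at hy
    simp only [SimpleGraph.Walk.getLast_support, List.head?_cons, Option.mem_def,
      Option.some.injEq] at hx hy
    rw [← hx, ← hy]
    exact h

open Classical in
lemma countP_mem_le_ncard [Finite V] {s : Set V} {l : List V} (hl : l.Nodup) :
    l.countP (· ∈ s) ≤ s.ncard := by
  rw [List.countP_eq_length_filter, ← List.toFinset_card_of_nodup (hl.filter _),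
    ← Set.ncard_coe_finset]
  refine Set.ncard_le_ncard (fun x hx => ?_) s.toFinite
  simp at hx
  exact hx.2

open Classical in
lemma eq_of_countP_le_one {H : Set V} : ∀ {l : List V}, l.countP (· ∈ H) ≤ 1 →
    ∀ x ∈ l, x ∈ H → ∀ y ∈ l, y ∈ H → x = y := by
  intro l h x hx hxH y hy hyH
  rw [List.countP_eq_length_filter] at h
  have hx' : x ∈ l.filter (· ∈ H) := by simp [hx, hxH]
  have hy' : y ∈ l.filter (· ∈ H) := by simp [hy, hyH]
  obtain ⟨i, hi, rfl⟩ := List.getElem_of_mem hx'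
  obtain ⟨j, hj, rfl⟩ := List.getElem_of_mem hy'
  obtain rfl : i = j := by omega
  rfl

end CycleLists

/-- Let `d, k ≥ 1`, and let `G` be a 2-connected graph with a `d`-core `H` such that
`d ≥ 5k - 3` and `d > |V(H)| - k` (i.e. `|V(H)| < d + k`), and let
`p = d + k - |V(H)|`. Then `G` has a cycle with at least `d + k` vertices iff either
(i) there are distinct `s, t ∈ V(H)` and an `(s,t)`-path in `G` with all internal
vertices outside `V(H)` and at least `p` internal vertices, or (ii) `G` has a system
of `V(H)`-segments whose total number of vertices outside `V(H)` is at least `p` and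
at most `2p - 2`. -/
theorem cycle_iff_segments {V : Type*} [Fintype V] (G : SimpleGraph V)
    (d k : ℕ) (hd : 1 ≤ d) (hk : 1 ≤ k)
    (hconn : G.Connected) (h2c : ∀ v : V, (G.induce ({v}ᶜ : Set V)).Connected)
    (H : Set V) (hcore : IsDCore G d H)
    (hdk : 5 * k - 3 ≤ d) (hsmall : H.ncard < d + k) :
    (∃ (v : V) (c : G.Walk v v), c.IsCycle ∧ d + k ≤ c.length) ↔
    ((∃ s ∈ H, ∃ t ∈ H, s ≠ t ∧ ∃ q : G.Walk s t, q.IsPath ∧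
        (∀ x ∈ q.support.tail.dropLast, x ∉ H) ∧
        d + k - H.ncard ≤ q.support.tail.dropLast.length) ∨
     (∃ (r : ℕ) (P : Fin r → PathIn G), IsSegmentSystem G H P ∧
        d + k - H.ncard ≤ outsideCount H P ∧
        outsideCount H P ≤ 2 * (d + k - H.ncard) - 2)) := by
  classical
  have hdeg := hcore.2.1
  obtain ⟨⟨v₀, hv₀⟩⟩ := hcore.1.nonempty
  have hcard : d + 1 ≤ H.ncard := by
    rw [← Set.ncard_sdiff_singleton_add_one hv₀ H.toFinite]
    refine Nat.add_le_add_right ((hdeg v₀ hv₀).trans (Set.ncard_le_ncard ?_ (Set.toFinite _))) 1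
    rintro x ⟨hx, hxH⟩
    exact ⟨hxH, fun h => G.ne_of_adj hx (Set.mem_singleton_iff.1 h).symm⟩
  have hnt : H.Nontrivial := (Set.one_lt_ncard_iff_nontrivial (s := H)).1 (by omega)
  constructor
  · rintro ⟨v, c, hc, hlen⟩
    obtain ⟨L, hnd, hL, hLc⟩ := exists_list_of_isCycle hc
    have hle := countP_mem_le_ncard (s := H) hnd
    have hadd := List.length_eq_countP_add_countP (fun x => decide (x ∈ H)) (l := L)
    simp only [decide_eq_true_eq] at hadd
    rcases le_or_gt (L.countP (· ∈ H)) 1 with h | h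
    · exact Or.inl (exists_path_of_subsingleton h2c hnt hnd hL (by omega) (eq_of_countP_le_one h))
    · exact exists_path_or_segments_of_two_le (by omega) hnd hL (by omega) h (by omega)
  · rintro (⟨s, hs, t, ht, hst, q, hq, hint, hlen⟩ | ⟨r, P, hP, hge, hle⟩)
    · obtain ⟨v, c, hc, hcl⟩ := exists_isCycle_of_path hdeg (by omega) hs ht hst q hq hint (by
        intro h
        rw [h, List.length_nil] at hlen
        omega)
      exact ⟨v, c, hc, by omega⟩
    · obtain ⟨v, c, hc, hcl⟩ := exists_isCycle_of_isSegmentSystem hdeg hP (by omega) (by omega)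
      exact ⟨v, c, hc, by omega⟩
end

section
/- Let d and k be positive integers with d ≥ 5k−3, let G be a 2-connected graph, and let H be a d-core of G with |V(H)| ≥ d+k. Then G contains a cycle with at least d+k vertices. -/
open SimpleGraph

/-- `PathOn G u v S`: there is a path of `G` from `u` to `v` with vertex set `S`. -/
inductive PathOn {V : Type*} [DecidableEq V] (G : SimpleGraph V) : V → V → Finset V → Prop
  | single (u : V) : PathOn G u u {u}
  | cons {u v w : V} {S : Finset V} (h : G.Adj u v) (hu : u ∉ S) (hS : PathOn G v w S) :
      PathOn G u w (insert u S)

namespace PathOn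

variable {V : Type*} [DecidableEq V] {G : SimpleGraph V} {u v w z : V} {S T : Finset V}

theorem start_mem (h : PathOn G u v S) : u ∈ S := by
  cases h <;> simp

theorem end_mem (h : PathOn G u v S) : v ∈ S := by
  induction h with
  | single => simp
  | cons _ _ _ ih => simp [ih]

theorem append (hS : PathOn G u v S) (h : G.Adj v w) (hT : PathOn G w z T)
    (hd : Disjoint S T) : PathOn G u z (S ∪ T) := by
  induction hS with
  | single u => exact cons h (by simpa using hd) hT
  | cons h' hu _ ih =>
    rw [Finset.disjoint_insert_left] at hd
    rw [Finset.insert_union]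
    exact cons h' (by simp [hu, hd.1]) (ih h hd.2)

theorem symm (h : PathOn G u v S) : PathOn G v u S := by
  induction h with
  | single u => exact single u
  | @cons u v w S h hu _ ih =>
    have := ih.append h.symm (single u) (by simpa using hu)
    rwa [Finset.union_comm, ← Finset.insert_eq] at this

theorem glue (hS : PathOn G u v S) (hT : PathOn G v w T) (hd : ∀ x ∈ S, x ∈ T → x = v) :
    PathOn G u w (S ∪ T) := by
  cases hT with
  | single v =>
    have := hS.end_mem
    rwa [Finset.union_eq_left.2 (by simpa using this)]
  | @cons _ v' _ T h hv hT =>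
    have hv' := hS.end_mem
    have : S ∪ insert v T = S ∪ T := by grind
    rw [this]
    exact hS.append h hT (Finset.disjoint_left.2 fun x hx hx' => by grind)

theorem split (h : PathOn G u v S) (hz : z ∈ S) :
    ∃ S₁ S₂, PathOn G u z S₁ ∧ PathOn G z v S₂ ∧ S₁ ∪ S₂ = S ∧
      ∀ x ∈ S₁, x ∈ S₂ → x = z := by
  induction h with
  | single u =>
    obtain rfl := Finset.mem_singleton.1 hz
    exact ⟨{z}, {z}, single z, single z, by simp, by simp⟩
  | @cons u v w S h hu hS ih =>
    rcases Finset.mem_insert.1 hz with rfl | hz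
    · exact ⟨{z}, insert z S, single z, cons h hu hS, by simp, by simp⟩
    · obtain ⟨S₁, S₂, h₁, h₂, rfl, h₄⟩ := ih hz
      exact ⟨insert u S₁, S₂, cons h (by grind) h₁, h₂, by grind, by grind⟩

theorem exists_rotate (h : PathOn G u v S) (hvu : G.Adj v u) (hz : z ∈ S) :
    ∃ c, PathOn G z c S := by
  obtain ⟨S₁, S₂, h₁, h₂, rfl, h₄⟩ := h.split hz
  cases h₁.symm with
  | single => exact ⟨v, by rwa [Finset.union_eq_right.2 (by simpa using h₂.start_mem)]⟩
  | @cons _ c _ S h hzS hS =>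
    refine ⟨c, ?_⟩
    have : insert z S ∪ S₂ = S₂ ∪ S := by have := h₂.start_mem; grind
    rw [this]
    exact h₂.append hvu hS.symm (Finset.disjoint_left.2 fun x hx hx' => by grind)

theorem exists_walk (h : PathOn G u v S) :
    ∃ p : G.Walk u v, p.IsPath ∧ p.support.toFinset = S := by
  induction h with
  | single u => exact ⟨.nil, by simp, by simp⟩
  | cons h hu _ ih =>
    obtain ⟨p, hp, rfl⟩ := ih
    refine ⟨.cons h p, ?_, by simp⟩
    rw [Walk.cons_isPath_iff]
    exact ⟨hp, by simpa using hu⟩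

theorem exists_cycle (h : PathOn G u v S) (hvu : G.Adj v u) (hS : 3 ≤ S.card) :
    ∃ c : G.Walk v v, c.IsCycle ∧ c.length = S.card := by
  obtain ⟨p, hp, rfl⟩ := h.exists_walk
  rw [List.toFinset_card_of_nodup hp.support_nodup, Walk.length_support] at hS
  rw [List.toFinset_card_of_nodup hp.support_nodup, Walk.length_support]
  refine ⟨.cons hvu p, ?_, by simp⟩
  rw [Walk.cons_isCycle_iff]
  refine ⟨hp, fun he => ?_⟩
  have := hp.length_eq_one_of_mem_edges (Sym2.eq_swap ▸ he)
  omega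

theorem exists_cycle_of_two (hS : PathOn G u v S) (hT : PathOn G v u T) (huv : u ≠ v)
    (hST : ∀ x ∈ S, x ∈ T → x = u ∨ x = v) (hc : 3 ≤ (S ∪ T).card) :
    ∃ (x : V) (c : G.Walk x x), c.IsCycle ∧ c.length = (S ∪ T).card := by
  cases hT with
  | single => exact absurd rfl huv
  | @cons _ v' _ T h hv hT =>
    have hu := hS.start_mem
    have hv' := hS.end_mem
    have hu' := hT.end_mem
    have key := hS.symm.glue hT.symm fun x hx hx' => by grind
    have e : S ∪ T = S ∪ insert v T := by grind
    rw [e] at key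
    obtain ⟨c, hc⟩ := key.exists_cycle h.symm hc
    exact ⟨_, c, hc⟩

theorem of_walk_induce {s : Set V} {a b : s} (p : (G.induce s).Walk a b) :
    ∃ Q, PathOn G a b Q ∧ (Q : Set V) ⊆ s := by
  induction p with
  | @nil a => exact ⟨{a.1}, single _, by simp⟩
  | @cons a b c h p ih =>
    obtain ⟨Q, hQ, hQs⟩ := ih
    by_cases ha : a.1 ∈ Q
    · obtain ⟨S₁, S₂, h₁, h₂, rfl, h₄⟩ := hQ.split ha
      exact ⟨S₂, h₂, fun x hx => hQs (Finset.mem_coe.2 (Finset.mem_union_right _ hx))⟩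
    · refine ⟨insert a.1 Q, cons h ha hQ, ?_⟩
      simpa [Set.insert_subset_iff] using hQs

/-- In a graph such that `G - v` is connected, two disjoint nonempty sets avoiding `v` are joined
by a path that avoids `v` and meets each of them only in its ends. -/
theorem exists_bridge (h2c : (G.induce ({v}ᶜ : Set V)).Connected) {C D : Finset V}
    (hC : C.Nonempty) (hD : D.Nonempty) (hvC : v ∉ C) (hvD : v ∉ D) :
    ∃ c ∈ C, ∃ e ∈ D, ∃ Q, PathOn G c e Q ∧ (∀ x ∈ Q, x ∈ C → x = c) ∧
      (∀ x ∈ Q, x ∈ D → x = e) ∧ v ∉ Q := by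
  classical
  let P : ℕ → Prop := fun n => ∃ c ∈ C, ∃ e ∈ D, ∃ Q, PathOn G c e Q ∧ v ∉ Q ∧ Q.card = n
  have hP : ∃ n, P n := by
    obtain ⟨c, hc⟩ := hC
    obtain ⟨e, he⟩ := hD
    obtain ⟨p⟩ := h2c.preconnected ⟨c, fun h => hvC (h ▸ hc)⟩ ⟨e, fun h => hvD (h ▸ he)⟩
    obtain ⟨Q, hQ, hQs⟩ := of_walk_induce p
    exact ⟨_, c, hc, e, he, Q, hQ, fun h => hQs h rfl, rfl⟩
  obtain ⟨c, hc, e, he, Q, hQ, hvQ, hcard⟩ := Nat.find_spec hP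
  refine ⟨c, hc, e, he, Q, hQ, fun z hz hzC => ?_, fun z hz hzD => ?_, hvQ⟩
  · by_contra hzc
    obtain ⟨S₁, S₂, h₁, h₂, rfl, h₄⟩ := hQ.split hz
    have hcS : c ∉ S₂ := fun h => hzc (h₄ c h₁.start_mem h).symm
    have hlt : S₂.card < (S₁ ∪ S₂).card := Finset.card_lt_card
      ⟨Finset.subset_union_right, fun h => hcS (h (by simp [h₁.start_mem]))⟩
    exact Nat.find_min hP (hcard ▸ hlt) ⟨z, hzC, e, he, S₂, h₂, by simp_all, rfl⟩
  · by_contra hze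
    obtain ⟨S₁, S₂, h₁, h₂, rfl, h₄⟩ := hQ.split hz
    have heS : e ∉ S₁ := fun h => hze (h₄ e h h₂.end_mem).symm
    have hlt : S₁.card < (S₁ ∪ S₂).card := Finset.card_lt_card
      ⟨Finset.subset_union_left, fun h => heS (h (by simp [h₂.end_mem]))⟩
    exact Nat.find_min hP (hcard ▸ hlt) ⟨c, hc, z, hzD, S₁, h₁, by simp_all, rfl⟩

theorem exists_enumeration (h : PathOn G u v S) :
    ∃ (p : ℕ → V) (m : ℕ), p 0 = u ∧ p m = v ∧ Set.InjOn p (Set.Iic m) ∧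
      (∀ i < m, G.Adj (p i) (p (i + 1))) ∧ S = (Finset.Icc 0 m).image p := by
  induction h with
  | single u => exact ⟨fun _ => u, 0, rfl, rfl, fun i hi j hj _ => by simp_all, by simp, by simp⟩
  | @cons u v w S h hu _ ih =>
    obtain ⟨p, m, rfl, rfl, hinj, hadj, rfl⟩ := ih
    have hu' : ∀ i ≤ m, p i ≠ u := by simpa using hu
    refine ⟨fun i => Nat.casesOn i u p, m + 1, rfl, rfl, ?_, ?_, ?_⟩
    · rintro (_ | i) hi (_ | j) hj hij
      · rfl
      · exact absurd hij.symm (hu' j (by simpa using hj))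
      · exact absurd hij (hu' i (by simpa using hi))
      · exact congrArg _ (hinj (by simpa using hi) (by simpa using hj) hij)
    · rintro (_ | i) hi
      · exact h
      · exact hadj i (by omega)
    · ext x
      simp only [Finset.mem_insert, Finset.mem_image, Finset.mem_Icc, zero_le, true_and]
      constructor
      · rintro (rfl | ⟨i, hi, rfl⟩)
        · exact ⟨0, by omega, rfl⟩
        · exact ⟨i + 1, by omega, rfl⟩
      · rintro ⟨_ | i, hi, rfl⟩
        · exact Or.inl rfl
        · exact Or.inr ⟨i, by omega, rfl⟩

theorem segment {p : ℕ → V} {m : ℕ} (hinj : Set.InjOn p (Set.Iic m))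
    (hadj : ∀ i < m, G.Adj (p i) (p (i + 1))) {i j : ℕ} (hij : i ≤ j) (hj : j ≤ m) :
    PathOn G (p i) (p j) ((Finset.Icc i j).image p) := by
  induction j, hij using Nat.le_induction with
  | base => simpa using single (p i)
  | succ j hij ih =>
    rw [← Finset.insert_Icc_right_eq_Icc_add_one (by omega), Finset.image_insert]
    refine (cons (hadj j (by omega)).symm ?_ (ih (by omega)).symm).symm
    simp only [Finset.mem_image, Finset.mem_Icc, not_exists, not_and, and_imp]
    intro l _ hl he
    have := hinj (by simp; omega) (by simp; omega) he
    omega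

end PathOn

/-- `Linked G X x T t`: there are two disjoint `X`-`T` paths, one of them starting in `x`
and one of them ending in `t`. -/
def Linked {V : Type*} [DecidableEq V] (G : SimpleGraph V) (X : Finset V) (x : V)
    (T : Finset V) (t : V) : Prop :=
  ∃ s ∈ X, ∃ u ∈ T, ∃ v ∈ T, ∃ A B, (u = t ∨ v = t) ∧ PathOn G x u A ∧ PathOn G s v B ∧
    (∀ z ∈ A, z ∉ B) ∧ (∀ z ∈ A, z ∈ X → z = x) ∧ (∀ z ∈ B, z ∈ X → z = s) ∧
    (∀ z ∈ A, z ∈ T → z = u) ∧ (∀ z ∈ B, z ∈ T → z = v)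

namespace Linked

variable {V : Type*} [DecidableEq V] {G : SimpleGraph V} {X T : Finset V} {x w w' : V}

theorem refl (h2c : ∀ v : V, (G.induce ({v}ᶜ : Set V)).Connected) (hxT : x ∈ T)
    (hX : ∃ s ∈ X, s ≠ x) (hT : ∃ t ∈ T, t ≠ x) :
    Linked G X x T x := by
  obtain ⟨s, hs, hsx⟩ := hX
  obtain ⟨t, ht, htx⟩ := hT
  obtain ⟨c, hc, e, he, Q, hQ, hQX, hQT, hxQ⟩ := PathOn.exists_bridge (h2c x) (C := X.erase x)
    (D := T.erase x) ⟨s, by simp [*]⟩ ⟨t, by simp [*]⟩ (by simp) (by simp)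
  refine ⟨c, by grind, x, hxT, e, by grind, {x}, Q, Or.inl rfl, .single x, hQ, ?_⟩
  grind

theorem step (h2c : ∀ v : V, (G.induce ({v}ᶜ : Set V)).Connected)
    (h : Linked G X x (insert w T) w) (hxX : x ∈ X) (hw : w ∉ T) (hw' : w' ∈ T)
    (hadj : G.Adj w w') (hT : ∃ t ∈ T, t ≠ w') (hXT : ∀ z ∈ X, z ∉ T) : Linked G X x T w' := by
  obtain ⟨s, hs, u, hu, v, hv, A, B, hend, hA, hB, hAB, hAX, hBX, hAT, hBT⟩ := h
  have hxA := hA.start_mem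
  have hsB := hB.start_mem
  have huA := hA.end_mem
  have hvB := hB.end_mem
  obtain ⟨t, htT, ht⟩ := hT
  obtain ⟨c, hc, e, he, Q, hQ, hQX, hQT, hxQ⟩ := PathOn.exists_bridge (h2c w')
    (C := (X ∪ A ∪ B).erase w') (D := T.erase w') ⟨s, by grind⟩ ⟨t, by grind⟩ (by simp) (by simp)
  have hcQ := hQ.start_mem
  have heQ := hQ.end_mem
  have hcw : c ≠ w' := by grind
  have hQA : ∀ z ∈ Q, z ∈ A → z = c := by grind
  have hQB : ∀ z ∈ Q, z ∈ B → z = c := by grind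
  rcases hend with rfl | rfl
  · have hA' : w' ∉ A → PathOn G x w' (A ∪ {w'}) := fun h =>
      hA.append hadj (.single w') (by simpa using h)
    by_cases hvw : v = w'
    · subst hvw
      by_cases hcA : c ∈ A
      · obtain ⟨S₁, S₂, h₁, h₂, rfl, h₄⟩ := hA.split hcA
        refine ⟨s, hs, e, by grind, v, hw', _, B, Or.inr rfl, h₁.glue hQ (by grind), hB, ?_, ?_,
          ?_, ?_, ?_⟩ <;> grind
      by_cases hcB : c ∈ B
      · obtain ⟨S₁, S₂, h₁, h₂, rfl, h₄⟩ := hB.split hcB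
        have : v ∉ S₁ := fun h => hcw (h₄ v h h₂.end_mem).symm
        refine ⟨s, hs, v, hw', e, by grind, _, _, Or.inl rfl, hA' (by grind),
          h₁.glue hQ (by grind), ?_, ?_, ?_, ?_, ?_⟩ <;> grind
      · refine ⟨c, by grind, v, hw', e, by grind, _, _, Or.inl rfl, hA' (by grind), hQ, ?_, ?_,
        ?_, ?_, ?_⟩ <;> grind
    · have : w' ∉ B := by grind
      refine ⟨s, hs, w', hw', v, by grind, _, B, Or.inl rfl, hA' (by grind), hB, ?_, ?_,
        ?_, ?_, ?_⟩ <;> grind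
  · have hB' : w' ∉ B → PathOn G s w' (B ∪ {w'}) := fun h =>
      hB.append hadj (.single w') (by simpa using h)
    by_cases huw : u = w'
    · subst huw
      by_cases hcB : c ∈ B
      · obtain ⟨S₁, S₂, h₁, h₂, rfl, h₄⟩ := hB.split hcB
        refine ⟨s, hs, u, hw', e, by grind, A, _, Or.inl rfl, hA, h₁.glue hQ (by grind), ?_, ?_,
          ?_, ?_, ?_⟩ <;> grind
      by_cases hcA : c ∈ A
      · obtain ⟨S₁, S₂, h₁, h₂, rfl, h₄⟩ := hA.split hcA
        have : u ∉ S₁ := fun h => hcw (h₄ u h h₂.end_mem).symm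
        refine ⟨s, hs, e, by grind, u, hw', _, _, Or.inr rfl, h₁.glue hQ (by grind),
          hB' (by grind), ?_, ?_, ?_, ?_, ?_⟩ <;> grind
      · refine ⟨c, by grind, u, hw', e, by grind, A, Q, Or.inl rfl, hA, hQ, ?_, ?_,
        ?_, ?_, ?_⟩ <;> grind
    · have : w' ∉ A := by grind
      refine ⟨s, hs, u, by grind, w', hw', A, _, Or.inr rfl, hA, hB' (by grind), ?_, ?_,
        ?_, ?_, ?_⟩ <;> grind

end Linked

section Cycles

variable {V : Type*} [DecidableEq V] {G : SimpleGraph V} {p : ℕ → V} {m a b : ℕ}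

/-- If the first vertex `p 0` of a path is adjacent to `p a`, then for every `s < a` the initial
segment up to `p a` contains a path from `p s` to `p a` through `p 0` and all its neighbours. -/
theorem PathOn.exists_cover (hinj : Set.InjOn p (Set.Iic m))
    (hadj : ∀ i < m, G.Adj (p i) (p (i + 1))) (ham : a ≤ m) (ha : G.Adj (p 0) (p a)) {s : ℕ}
    (hs : s < a) :
    ∃ S, PathOn G (p s) (p a) S ∧ S ⊆ (Finset.Icc 0 a).image p ∧ p 0 ∈ S ∧
      ∀ i ≤ a, G.Adj (p 0) (p i) → p i ∈ S := by
  classical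
  have hex : ∃ i, s < i ∧ i ≤ a ∧ G.Adj (p 0) (p i) := ⟨a, hs, le_rfl, ha⟩
  obtain ⟨h₁, h₂, h₃⟩ := Nat.find_spec hex
  have hmin : ∀ i, s < i → i ≤ a → G.Adj (p 0) (p i) → Nat.find hex ≤ i :=
    fun i hi hi' h => Nat.find_min' hex ⟨hi, hi', h⟩
  generalize Nat.find hex = r at h₁ h₂ h₃ hmin
  refine ⟨_, (PathOn.segment hinj hadj s.zero_le (by omega)).symm.append h₃
    (PathOn.segment hinj hadj h₂ ham) ?_, ?_, ?_, ?_⟩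
  · simp only [Finset.disjoint_left, Finset.mem_image, Finset.mem_Icc, not_exists, not_and]
    rintro _ ⟨i, hi, rfl⟩ j hj he
    have := hinj (by simp; omega) (by simp; omega) he
    omega
  · rw [← Finset.image_union]
    refine Finset.image_subset_image fun i => ?_
    simp only [Finset.mem_union, Finset.mem_Icc]
    omega
  · exact Finset.mem_union_left _ (Finset.mem_image_of_mem p (by simp))
  · intro i hi h
    by_cases his : i ≤ s
    · exact Finset.mem_union_left _ (Finset.mem_image_of_mem p (by simp [his]))
    · have := hmin i (by omega) hi h
      exact Finset.mem_union_right _ (Finset.mem_image_of_mem p (by simp [*]))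

/-- If the neighbours of the first vertex of a path precede those of its last vertex, then a
2-connected graph has a cycle through both ends and all their neighbours on the path. -/
theorem exists_cycle_of_separated_ends (h2c : ∀ v : V, (G.induce ({v}ᶜ : Set V)).Connected)
    (hinj : Set.InjOn p (Set.Iic m)) (hadj : ∀ i < m, G.Adj (p i) (p (i + 1)))
    (ha₀ : 0 < a) (hab : a ≤ b) (hbm : b < m)
    (ha : G.Adj (p 0) (p a)) (hb : G.Adj (p m) (p b)) {N₀ N₁ : Finset V}
    (hN : 2 ≤ N₀.card + N₁.card)
    (hN₀ : ∀ x ∈ N₀, G.Adj (p 0) x ∧ ∃ i ≤ a, p i = x)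
    (hN₁ : ∀ x ∈ N₁, G.Adj (p m) x ∧ ∃ i ≤ m, b ≤ i ∧ p i = x) :
    ∃ (v : V) (c : G.Walk v v), c.IsCycle ∧ N₀.card + N₁.card < c.length := by
  have hp : ∀ i ≤ m, ∀ j ≤ m, p i = p j → i = j := fun i hi j hj h => hinj hi hj h
  set X := (Finset.Icc 0 a).image p with hX
  have hXmem : ∀ z, z ∈ X ↔ ∃ i ≤ a, p i = z := by simp [hX]
  have hTmem : ∀ j z, z ∈ (Finset.Icc j m).image p ↔ ∃ i ≤ m, j ≤ i ∧ p i = z := by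
    intro j z
    simp only [Finset.mem_image, Finset.mem_Icc]
    exact ⟨fun ⟨i, h, e⟩ => ⟨i, h.2, h.1, e⟩, fun ⟨i, h, h', e⟩ => ⟨i, ⟨h', h⟩, e⟩⟩
  have hlink : ∀ j, a ≤ j → j ≤ b → Linked G X (p a) ((Finset.Icc j m).image p) (p j) := by
    intro j haj
    induction j, haj using Nat.le_induction with
    | base =>
      intro _
      refine Linked.refl h2c ((hTmem _ _).2 ⟨a, by omega, le_rfl, rfl⟩)
        ⟨p 0, (hXmem _).2 ⟨0, by omega, rfl⟩, fun h => ?_⟩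
        ⟨p m, (hTmem _ _).2 ⟨m, by omega, by omega, rfl⟩, fun h => ?_⟩
      · have := hp _ (by omega) _ (by omega) h
        omega
      · have := hp _ (by omega) _ (by omega) h
        omega
    | succ j haj ih =>
      intro hjb
      have ih := ih (by omega)
      rw [← Finset.insert_Icc_add_one_left_eq_Icc (by omega), Finset.image_insert] at ih
      refine ih.step h2c ((hXmem _).2 ⟨a, le_rfl, rfl⟩) (fun h => ?_)
        ((hTmem _ _).2 ⟨j + 1, by omega, le_rfl, rfl⟩) (hadj j (by omega))
        ⟨p m, (hTmem _ _).2 ⟨m, by omega, by omega, rfl⟩, fun h => ?_⟩ fun z hz hz' => ?_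
      · obtain ⟨i, hi, hi', e⟩ := (hTmem _ _).1 h
        have := hp i hi j (by omega) e
        omega
      · have := hp _ (by omega) _ (by omega) h
        omega
      · obtain ⟨i, hi, rfl⟩ := (hXmem _).1 hz
        obtain ⟨l, hl, hl', e⟩ := (hTmem _ _).1 hz'
        have := hp l hl i (by omega) e
        omega
  obtain ⟨x, hx, u, hu, v, hv, A, B, hend, hA, hB, hAB, hAX, hBX, hAT, hBT⟩ := hlink b hab le_rfl
  have hxA := hA.start_mem
  have huA := hA.end_mem
  have hxB := hB.start_mem
  have hvB := hB.end_mem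
  have hxa : p a ≠ x := by rintro rfl; exact hAB _ hxA hxB
  have huv : u ≠ v := by rintro rfl; exact hAB _ huA hvB
  obtain ⟨S, hS, hSX, hS₀, hSN⟩ : ∃ S, PathOn G x (p a) S ∧ S ⊆ X ∧ p 0 ∈ S ∧ N₀ ⊆ S := by
    obtain ⟨s, hs, rfl⟩ := (hXmem x).1 hx
    have : s ≠ a := fun h => hxa (by rw [h])
    obtain ⟨S, h₁, h₂, h₃, h₄⟩ := PathOn.exists_cover hinj hadj (by omega) ha
      (lt_of_le_of_ne hs this)
    refine ⟨S, h₁, h₂, h₃, fun z hz => ?_⟩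
    obtain ⟨hz, i, hi, rfl⟩ := hN₀ z hz
    exact h₄ i hi hz
  obtain ⟨T, hT, hTY, hT₀, hTN⟩ : ∃ T, PathOn G u v T ∧ T ⊆ (Finset.Icc b m).image p ∧
      p m ∈ T ∧ N₁ ⊆ T := by
    have key : ∀ t ≤ m, b < t → ∃ T, PathOn G (p t) (p b) T ∧ T ⊆ (Finset.Icc b m).image p ∧
        p m ∈ T ∧ N₁ ⊆ T := by
      intro t ht hbt
      have hinj' : Set.InjOn (fun i => p (m - i)) (Set.Iic m) := fun i hi j hj h => by
        have := hp _ (by omega) _ (by omega) h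
        simp only [Set.mem_Iic] at hi hj
        omega
      have hadj' : ∀ i < m, G.Adj (p (m - i)) (p (m - (i + 1))) := fun i hi => by
        have := (hadj (m - (i + 1)) (by omega)).symm
        rwa [show m - (i + 1) + 1 = m - i by omega] at this
      have hb' : G.Adj (p (m - 0)) (p (m - (m - b))) := by
        rwa [show m - (m - b) = b by omega, Nat.sub_zero]
      obtain ⟨T, h₁, h₂, h₃, h₄⟩ := PathOn.exists_cover hinj' hadj' (Nat.sub_le m b) hb'
        (s := m - t) (by omega)
      have e : m - (m - t) = t := by omega
      have e' : m - (m - b) = b := by omega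
      simp only [e, e', Nat.sub_zero] at h₁ h₃ h₄
      refine ⟨T, h₁, h₂.trans fun z hz => ?_, h₃, fun z hz => ?_⟩
      · obtain ⟨i, hi, rfl⟩ := Finset.mem_image.1 hz
        rw [Finset.mem_Icc] at hi
        exact (hTmem _ _).2 ⟨m - i, by omega, by omega, rfl⟩
      · obtain ⟨hz, i, hi, hi', rfl⟩ := hN₁ z hz
        have e : m - (m - i) = i := by omega
        have := h₄ (m - i) (by omega)
        rw [e] at this
        exact this hz
    rcases hend with rfl | rfl
    · obtain ⟨t, ht, hbt, rfl⟩ := (hTmem _ _).1 hv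
      have : t ≠ b := by rintro rfl; exact huv rfl
      obtain ⟨T, hT, h⟩ := key t ht (by omega)
      exact ⟨T, hT.symm, h⟩
    · obtain ⟨t, ht, hbt, rfl⟩ := (hTmem _ _).1 hu
      have : t ≠ b := by rintro rfl; exact huv rfl
      exact key t ht (by omega)
  have hXT : ∀ z ∈ X, z ∈ (Finset.Icc b m).image p → z = p a := by
    intro z hz hz'
    obtain ⟨i, hi, rfl⟩ := (hXmem _).1 hz
    obtain ⟨l, hl, hl', e⟩ := (hTmem _ _).1 hz'
    have := hp l hl i (by omega) e
    congr 1; omega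
  have hR := (hA.glue hT fun z hz hz' => hAT z hz (hTY hz')).glue hB.symm fun z hz hz' => by
    rcases Finset.mem_union.1 hz with h | h
    · exact absurd hz' (hAB z h)
    · exact hBT z hz' (hTY h)
  have hsub : insert (p 0) N₀ ∪ insert (p m) N₁ ⊆ S ∪ (A ∪ T ∪ B) := by grind
  have hcard : N₀.card + N₁.card < (insert (p 0) N₀ ∪ insert (p m) N₁).card := by
    have h₀ : (insert (p 0) N₀).card = N₀.card + 1 :=
      Finset.card_insert_of_notMem fun h => (hN₀ _ h).1.ne rfl
    have h₁ : (insert (p m) N₁).card = N₁.card + 1 :=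
      Finset.card_insert_of_notMem fun h => (hN₁ _ h).1.ne rfl
    have h₂ : (insert (p 0) N₀ ∩ insert (p m) N₁).card ≤ 1 := by
      refine (Finset.card_le_card fun z hz => ?_).trans (Finset.card_singleton (p a)).le
      rw [Finset.mem_inter] at hz
      exact Finset.mem_singleton.2 (hXT z (hSX (by grind)) (hTY (by grind)))
    have := Finset.card_union_add_card_inter (insert (p 0) N₀) (insert (p m) N₁)
    omega
  have h3 : 3 ≤ (S ∪ (A ∪ T ∪ B)).card := by
    have := Finset.card_le_card hsub
    omega
  obtain ⟨w, c, hc, hcl⟩ := hS.exists_cycle_of_two hR hxa.symm (fun z hz hz' => by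
    have := hXT z (hSX hz)
    have := hAX z
    have := hBX z
    grind) h3
  exact ⟨w, c, hc, hcl ▸ hcard.trans_le (Finset.card_le_card hsub)⟩

end Cycles

theorem exists_adj_notMem_of_induce_connected {V : Type*} {G : SimpleGraph V} {H S : Set V}
    (hH : (G.induce H).Connected) (hSH : S ⊆ H) (hS : S.Nonempty) (hne : ¬ H ⊆ S) :
    ∃ x ∈ S, ∃ y ∈ H, y ∉ S ∧ G.Adj x y := by
  obtain ⟨x, hx⟩ := hS
  obtain ⟨y, hy, hyS⟩ := Set.not_subset.1 hne
  obtain ⟨q⟩ := hH.preconnected ⟨x, hSH hx⟩ ⟨y, hy⟩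
  obtain ⟨e, -, he, he'⟩ := q.exists_boundary_dart {z | z.1 ∈ S} hx hyS
  exact ⟨_, he, _, e.snd.2, he', e.adj⟩

/-- A 2-connected graph containing a connected subgraph with minimum degree at least `d` on at
least `n ≤ 2 * d` vertices has a cycle of length at least `n`. -/
theorem exists_cycle_of_connected_of_minDegree {V : Type*} [Fintype V] {G : SimpleGraph V}
    (h2c : ∀ v : V, (G.induce ({v}ᶜ : Set V)).Connected) {H : Set V} {d n : ℕ}
    (hn : n ≤ 2 * d) (hn3 : 3 ≤ n) (hH : (G.induce H).Connected)
    (hdeg : ∀ v ∈ H, d ≤ (G.neighborSet v ∩ H).ncard) (hbig : n ≤ H.ncard) :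
    ∃ (v : V) (c : G.Walk v v), c.IsCycle ∧ n ≤ c.length := by
  classical
  obtain ⟨S, hS, hmax⟩ := Finset.exists_max_image
    (Finset.univ.filter fun S : Finset V => (S : Set V) ⊆ H ∧ ∃ u v, PathOn G u v S)
    Finset.card (by
      obtain ⟨x, hx⟩ := hH.nonempty
      exact ⟨{x}, by simpa [hx] using ⟨x, x, PathOn.single x⟩⟩)
  simp only [Finset.mem_filter, Finset.mem_univ, true_and, and_imp, forall_exists_index] at hS hmax
  obtain ⟨hSH, u, v, hP⟩ := hS
  have hext : ∀ u' v' w, PathOn G u' v' S → w ∈ H → G.Adj w u' → w ∈ S := by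
    intro u' v' w hP' hw hadj
    by_contra hwS
    have := hmax (insert w S) (by simp [Set.insert_subset_iff, hw, hSH]) _ _ (.cons hadj hwS hP')
    rw [Finset.card_insert_of_notMem hwS] at this
    omega
  have hspan : ∀ u' v', PathOn G u' v' S → G.Adj v' u' →
      ∃ (v : V) (c : G.Walk v v), c.IsCycle ∧ n ≤ c.length := by
    intro u' v' hP' hadj
    have hHS : H ⊆ S := by
      by_contra hne
      obtain ⟨x, hx, y, hy, hyS, hxy⟩ := exists_adj_notMem_of_induce_connected hH hSH ⟨u, hP.start_mem⟩ hne
      obtain ⟨c, hc⟩ := hP'.exists_rotate hadj hx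
      exact hyS (hext _ _ _ hc hy hxy.symm)
    have hcard : n ≤ S.card := by
      rw [← Set.ncard_coe_finset]
      exact hbig.trans (Set.ncard_le_ncard hHS)
    obtain ⟨c, hc, hcl⟩ := hP'.exists_cycle hadj (hn3.trans hcard)
    exact ⟨_, c, hc, hcl ▸ hcard⟩
  obtain ⟨p, m, rfl, rfl, hinj, hadj, hSp⟩ := hP.exists_enumeration
  have hmem : ∀ i ≤ m, p i ∈ H := fun i hi => hSH (by
    rw [hSp]
    exact Finset.mem_coe.2 (Finset.mem_image_of_mem p (by simpa using hi)))
  have hends : ∀ u' v', PathOn G u' v' S → u' ∈ H →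
      d ≤ ((Finset.Icc 0 m).filter fun i => G.Adj u' (p i)).card := by
    intro u' v' hP' hu'
    refine (hdeg u' hu').trans ?_
    have : G.neighborSet u' ∩ H ⊆
        (((Finset.Icc 0 m).filter fun i => G.Adj u' (p i)).image p : Finset V) := by
      rintro w ⟨hw, hwH⟩
      have hwS := hext _ _ w hP' hwH (G.adj_symm hw)
      rw [hSp, Finset.mem_image] at hwS
      obtain ⟨i, hi, rfl⟩ := hwS
      exact Finset.mem_coe.2 (Finset.mem_image_of_mem p (Finset.mem_filter.2 ⟨hi, hw⟩))
    refine (Set.ncard_le_ncard this).trans ?_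
    rw [Set.ncard_coe_finset]
    exact Finset.card_image_le
  have hA := hends _ _ hP (hmem 0 (by omega))
  have hB := hends _ _ hP.symm (hmem m le_rfl)
  set A := (Finset.Icc 0 m).filter fun i => G.Adj (p 0) (p i) with hAdef
  set B := (Finset.Icc 0 m).filter fun i => G.Adj (p m) (p i) with hBdef
  have hAmem : ∀ i, i ∈ A ↔ i ≤ m ∧ G.Adj (p 0) (p i) := by simp [hAdef]
  have hBmem : ∀ i, i ∈ B ↔ i ≤ m ∧ G.Adj (p m) (p i) := by simp [hBdef]
  have hA0 : ∀ i ∈ A, 0 < i := fun i hi => Nat.pos_of_ne_zero fun h =>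
    ((hAmem i).1 hi).2.ne (by rw [h])
  have hBm : ∀ i ∈ B, i < m := fun i hi => lt_of_le_of_ne ((hBmem i).1 hi).1 fun h =>
    ((hBmem i).1 hi).2.ne (by rw [h])
  by_cases hcross : ∃ l, ∃ i ∈ B, i + 1 + l ∈ A
  · obtain ⟨i, hi, hj⟩ := Nat.find_spec hcross
    have hmin : ∀ i' ∈ B, ∀ j' ∈ A, i' < j' → Nat.find hcross + i' < j' := by
      intro i' hi' j' hj' hlt
      have := Nat.find_min' hcross (m := j' - i' - 1)
        ⟨i', hi', by rwa [show i' + 1 + (j' - i' - 1) = j' by omega]⟩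
      omega
    generalize Nat.find hcross = l at hj hmin
    obtain ⟨him, hi'⟩ := (hBmem _).1 hi
    obtain ⟨hjm, hj'⟩ := (hAmem _).1 hj
    have hpath := (PathOn.segment hinj hadj i.zero_le (by omega)).symm.append hj'
      (PathOn.segment hinj hadj hjm le_rfl) (by
        simp only [Finset.disjoint_left, Finset.mem_image, Finset.mem_Icc, not_exists, not_and]
        rintro _ ⟨i, hi, rfl⟩ j hj he
        have := hinj (by simp; omega) (by simp; omega) he
        omega)
    rw [← Finset.image_union] at hpath
    rcases Nat.eq_zero_or_pos l with rfl | hl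
    · refine hspan _ _ ?_ hi'
      convert hpath using 1
      rw [hSp]
      congr 1
      ext x
      simp only [Finset.mem_union, Finset.mem_Icc]
      omega
    · have hcard : ((Finset.Icc 0 i ∪ Finset.Icc (i + 1 + l) m).image p).card =
          (i + 1) + (m - (i + l)) := by
        rw [Finset.card_image_of_injOn, Finset.card_union_of_disjoint, Nat.card_Icc, Nat.card_Icc]
        · omega
        · simp only [Finset.disjoint_left, Finset.mem_Icc]
          omega
        · refine hinj.mono fun x => ?_
          simp only [Finset.coe_union, Finset.coe_Icc, Set.mem_union, Set.mem_Icc, Set.mem_Iic]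
          omega
      have hcount : A.card + B.card ≤ (i + 1) + (m - (i + l)) := by
        have h₁ : (A.image (· - 1)).card = A.card := by
          refine Finset.card_image_of_injOn fun x hx y hy h => ?_
          have := hA0 x hx
          have := hA0 y hy
          omega
        have h₂ : Disjoint (A.image (· - 1)) B := by
          simp only [Finset.disjoint_left, Finset.mem_image]
          rintro _ ⟨x, hx, rfl⟩ hxB
          have := hA0 x hx
          have := hmin _ hxB x hx (by omega)
          omega
        have h₃ : A.image (· - 1) ∪ B ⊆ Finset.Icc 0 i ∪ Finset.Ico (i + l) m := by
          intro x hx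
          simp only [Finset.mem_union, Finset.mem_image, Finset.mem_Icc, Finset.mem_Ico] at hx ⊢
          rcases hx with ⟨x, hx, rfl⟩ | hx
          · have := hA0 x hx
            have := ((hAmem x).1 hx).1
            have := hmin i hi x hx
            omega
          · have := hBm x hx
            have := hmin x hx _ hj
            omega
        have := Finset.card_le_card h₃
        rw [Finset.card_union_of_disjoint h₂, h₁] at this
        refine this.trans ((Finset.card_union_le _ _).trans ?_)
        simp
      have hn' : n ≤ ((Finset.Icc 0 i ∪ Finset.Icc (i + 1 + l) m).image p).card := by omega
      obtain ⟨c, hc, hcl⟩ := hpath.exists_cycle hi' (hn3.trans hn')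
      exact ⟨_, c, hc, hcl ▸ hn'⟩
  · have hAne : A.Nonempty := Finset.card_pos.1 (by omega)
    have hBne : B.Nonempty := Finset.card_pos.1 (by omega)
    have ha := A.max'_mem hAne
    have hb := B.min'_mem hBne
    have hab : A.max' hAne ≤ B.min' hBne := by
      by_contra! h
      exact hcross ⟨A.max' hAne - B.min' hBne - 1, _, hb, by
        rwa [show B.min' hBne + 1 + (A.max' hAne - B.min' hBne - 1) = A.max' hAne by omega]⟩
    have hinjA : (A.image p).card = A.card := Finset.card_image_of_injOn
      (hinj.mono fun i hi => ((hAmem i).1 hi).1)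
    have hinjB : (B.image p).card = B.card := Finset.card_image_of_injOn
      (hinj.mono fun i hi => ((hBmem i).1 hi).1)
    obtain ⟨w, c, hc, hcl⟩ := exists_cycle_of_separated_ends h2c hinj hadj (hA0 _ ha) hab (hBm _ hb)
      ((hAmem _).1 ha).2 ((hBmem _).1 hb).2 (N₀ := A.image p) (N₁ := B.image p) (by omega)
      (by
        simp only [Finset.mem_image]
        rintro _ ⟨i, hi, rfl⟩
        exact ⟨((hAmem i).1 hi).2, i, A.le_max' i hi, rfl⟩)
      (by
        simp only [Finset.mem_image]
        rintro _ ⟨i, hi, rfl⟩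
        exact ⟨((hBmem i).1 hi).2, i, ((hBmem i).1 hi).1, B.min'_le i hi, rfl⟩)
    exact ⟨w, c, hc, by omega⟩

/-- Let `d, k ≥ 1` with `d ≥ 5k - 3`, let `G` be 2-connected, and let `H` be a
`d`-core of `G` with `|V(H)| ≥ d + k`. Then `G` contains a cycle with at least
`d + k` vertices. -/
theorem cycle_of_large_core {V : Type*} [Fintype V] (G : SimpleGraph V)
    (d k : ℕ) (hd : 1 ≤ d) (hk : 1 ≤ k) (hdk : 5 * k - 3 ≤ d)
    (hconn : G.Connected) (h2c : ∀ v : V, (G.induce ({v}ᶜ : Set V)).Connected)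
    (H : Set V) (hcore : IsDCore G d H) (hbig : d + k ≤ H.ncard) :
    ∃ (v : V) (c : G.Walk v v), c.IsCycle ∧ d + k ≤ c.length := by
  exact exists_cycle_of_connected_of_minDegree h2c (by omega) (by omega) hcore.1 hcore.2.1 hbig
end
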